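/- arXiv:0807.4503 — 2 statements merged into one kernel-verified Lean document; each statement's English description precedes it below -/
import Mathlib

section
/- If f is analytic on the unit disk and f' ∈ H^p for some p > 1, then f is a multiplier of F_0. -/
open MeasureTheory Metric Set Complex

noncomputable section

/-- A complex Borel measure on the unit circle, given by its polar decomposition:
a finite nonnegative measure (the total variation) together with a unimodular density. -/
structure CircleMeasure where
  ν : Measure (Metric.sphere (0:ℂ) 1)
  finite : IsFiniteMeasure ν
  w : Metric.sphere (0:ℂ) 1 → ℂ
  w_meas : Measurable w
  w_norm : ∀ ζ, ‖w ζ‖ = 1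

/-- Integral of a function against a complex measure. -/
def CircleMeasure.integral (μ : CircleMeasure) (f : Metric.sphere (0:ℂ) 1 → ℂ) : ℂ :=
  ∫ ζ, f ζ * μ.w ζ ∂μ.ν

/-- Total variation norm of a complex measure. -/
def CircleMeasure.norm (μ : CircleMeasure) : ℝ := (μ.ν Set.univ).toReal

/-- `μ` represents `g` in `F₀`: `g z = g 0 + ∫_T log(1/(1 - conj ζ · z)) dμ(ζ)` on the disk. -/
def RepF0 (g : ℂ → ℂ) (μ : CircleMeasure) : Prop :=
  ∀ z ∈ ball (0:ℂ) 1,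
    g z = g 0 + μ.integral (fun ζ => Complex.log (1 / (1 - (starRingEnd ℂ) (ζ:ℂ) * z)))

/-- Membership in the space `F₀`. -/
def MemF0 (g : ℂ → ℂ) : Prop :=
  DifferentiableOn ℂ g (ball 0 1) ∧ ∃ μ : CircleMeasure, RepF0 g μ

/-- The `F₀` norm: infimum of total variations of representing measures. -/
def normF0 (g : ℂ → ℂ) : ℝ := sInf {c | ∃ μ : CircleMeasure, RepF0 g μ ∧ μ.norm = c}

/-- `f` is a multiplier of `F₀`. -/
def MemM0 (f : ℂ → ℂ) : Prop :=
  DifferentiableOn ℂ f (ball 0 1) ∧ ∀ g, MemF0 g → MemF0 (fun z => f z * g z)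

/-- The multiplier norm on `m₀`. -/
def normM0 (f : ℂ → ℂ) : ℝ :=
  sSup {c | ∃ g, MemF0 g ∧ normF0 g ≤ 1 ∧ normF0 (fun z => f z * g z) = c}

/-- The `H^∞` norm: supremum of `‖f‖` on the unit disk. -/
def normHinf (f : ℂ → ℂ) : ℝ := sSup {c | ∃ z ∈ ball (0:ℂ) 1, ‖f z‖ = c}

open Filter Topology ProbabilityTheory

abbrev TT := Metric.sphere (0:ℂ) 1

def sgnT (z : ℂ) : TT :=
  if h : z = 0 then ⟨1, by simp⟩ else ⟨z / ‖z‖, by simp [h]⟩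

lemma sgnT_mul (z : ℂ) : (‖z‖ : ℂ) * (sgnT z : ℂ) = z := by
  unfold sgnT
  split_ifs with h
  · simp [h]
  · have : (‖z‖ : ℂ) ≠ 0 := by simpa using h
    field_simp

lemma sgnT_meas : Measurable sgnT := by
  have h : Measurable (fun z : ℂ => if z = 0 then (1:ℂ) else z / ‖z‖) :=
    Measurable.ite (measurableSet_singleton 0) measurable_const (by fun_prop)
  refine (MeasurableEmbedding.subtype_coe
    (s := Metric.sphere (0:ℂ) 1) isClosed_sphere.measurableSet).measurable_comp_iff.1 ?_
  convert h using 1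
  ext z
  unfold sgnT
  simp only [Function.comp]
  split_ifs <;> rfl

lemma TT_norm (ζ : TT) : ‖(ζ : ℂ)‖ = 1 := by simpa using ζ.2

/-- weak-star limit of finite measures on a compact space -/
lemma weak_limit {ι : Type*} (U : Ultrafilter ι) (C : NNReal)
    (M : ι → FiniteMeasure (TT × TT)) (hM : ∀ i, (M i).mass ≤ C) :
    ∃ N : FiniteMeasure (TT × TT), ∀ φ : TT → ℂ, Continuous φ →
      Tendsto (fun i => ∫ x, φ x.1 * (x.2 : ℂ) ∂(M i : Measure (TT × TT))) U
        (𝓝 (∫ x, φ x.1 * (x.2 : ℂ) ∂(N : Measure (TT × TT)))) := by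
  obtain ⟨N, -, hN⟩ := (isCompact_setOfPred_finiteMeasure_le_of_compactSpace
    (TT × TT) C).ultrafilter_le_nhds' (U.map M) (by
      simp only [Ultrafilter.mem_map]
      exact Filter.univ_mem' hM)
  refine ⟨N, fun φ hφ => ?_⟩
  have h1 : Tendsto M U (𝓝 N) := hN
  rw [FiniteMeasure.tendsto_iff_forall_integral_rclike_tendsto ℂ] at h1
  exact h1 (BoundedContinuousFunction.mkOfCompact
    ⟨fun x : TT × TT => φ x.1 * (x.2 : ℂ), by fun_prop⟩)

lemma density_measure {X : Type*} [MeasurableSpace X] (m : Measure X) (e : X → TT)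
    (he : Measurable e) (D : X → ℂ) (hD : Measurable D) (C : NNReal)
    (hC : ∫⁻ x, ‖D x‖ₑ ∂m ≤ C) :
    ∃ M : FiniteMeasure (TT × TT), M.mass ≤ C ∧ ∀ φ : TT → ℂ, Continuous φ →
      ∫ x, φ x.1 * (x.2 : ℂ) ∂(M : Measure (TT × TT)) = ∫ x, φ (e x) * D x ∂m := by
  have hmeas : Measurable (fun x => (e x, sgnT (D x))) := he.prodMk (sgnT_meas.comp hD)
  let M0 : Measure (TT × TT) := (m.withDensity (fun x => ‖D x‖ₑ)).map (fun x => (e x, sgnT (D x)))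
  have hmass : M0 univ ≤ C := by
    rw [Measure.map_apply hmeas MeasurableSet.univ]
    simpa using hC
  have : IsFiniteMeasure M0 := ⟨hmass.trans_lt (by simp)⟩
  let M1 : FiniteMeasure (TT × TT) := ⟨M0, inferInstance⟩
  refine ⟨M1, ?_, fun φ hφ => ?_⟩
  · rw [← ENNReal.coe_le_coe]
    have h2 : (M1.mass : ENNReal) = M0 univ := FiniteMeasure.ennreal_mass
    rw [h2]
    exact hmass
  · change ∫ x, φ x.1 * (x.2 : ℂ) ∂M0 = _
    rw [integral_map hmeas.aemeasurable (by
      exact (Continuous.aestronglyMeasurable (by fun_prop)))]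
    rw [integral_withDensity_eq_integral_toReal_smul (by fun_prop) (by simp)]
    congr 1; ext x
    simp only [toReal_enorm, real_smul]
    rw [mul_left_comm, sgnT_mul]

lemma realize (M : FiniteMeasure (TT × TT)) :
    ∃ μ : CircleMeasure, ∀ φ : TT → ℂ, Continuous φ →
      μ.integral φ = ∫ x, φ x.1 * (x.2 : ℂ) ∂(M : Measure (TT × TT)) := by
  have : Nonempty TT := ⟨⟨1, by simp⟩⟩
  let ρ : Measure (TT × TT) := M
  let D : TT → ℂ := fun ζ => ∫ u, (u : ℂ) ∂(ρ.condKernel ζ)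
  have hD : Measurable D := by
    apply StronglyMeasurable.measurable
    apply StronglyMeasurable.integral_kernel
    exact continuous_subtype_val.stronglyMeasurable
  have hD1 : ∀ ζ, ‖D ζ‖ ≤ 1 := by
    intro ζ
    refine (norm_integral_le_integral_norm _).trans ?_
    simp [TT_norm]
  have hfin : IsFiniteMeasure (ρ.fst.withDensity (fun x => ‖D x‖ₑ)) := by
    apply isFiniteMeasure_withDensity
    refine ne_of_lt (lt_of_le_of_lt (lintegral_mono (g := fun _ => 1) fun ζ => ?_) ?_)
    · have := hD1 ζ
      rw [← ofReal_norm]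
      exact ENNReal.ofReal_le_one.2 this
    · simp
  refine ⟨⟨ρ.fst.withDensity (fun x => ‖D x‖ₑ), hfin, fun ζ => (sgnT (D ζ) : ℂ),
    measurable_subtype_coe.comp (sgnT_meas.comp hD), fun ζ => TT_norm _⟩, fun φ hφ => ?_⟩
  change ∫ ζ, φ ζ * (sgnT (D ζ) : ℂ) ∂(ρ.fst.withDensity (fun x => ‖D x‖ₑ)) = _
  rw [integral_withDensity_eq_integral_toReal_smul (by fun_prop) (by simp)]
  rw [← Measure.integral_condKernel (ρ := ρ)]
  · congr 1; ext ζ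
    simp only [toReal_enorm, real_smul]
    rw [mul_left_comm, sgnT_mul, integral_const_mul]
  · obtain ⟨B, hB⟩ := (isCompact_univ (X := TT × TT)).exists_bound_of_continuousOn
      (f := fun x : TT × TT => φ x.1 * (x.2 : ℂ)) (Continuous.continuousOn (by fun_prop))
    exact Integrable.of_bound (Continuous.aestronglyMeasurable (by fun_prop)) B
      (Eventually.of_forall fun x => hB x (mem_univ _))

/-- Cauchy kernel -/
def KK (ζ : TT) (z : ℂ) : ℂ := (starRingEnd ℂ) (ζ:ℂ) / (1 - (starRingEnd ℂ) (ζ:ℂ) * z)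

def LL (ζ : TT) (z : ℂ) : ℂ := Complex.log (1 / (1 - (starRingEnd ℂ) (ζ:ℂ) * z))

lemma one_sub_norm (ζ : TT) (z : ℂ) : 1 - ‖z‖ ≤ ‖1 - (starRingEnd ℂ) (ζ:ℂ) * z‖ := by
  have := norm_sub_norm_le 1 ((starRingEnd ℂ) (ζ:ℂ) * z)
  simpa [TT_norm] using this

lemma one_sub_re (ζ : TT) {z : ℂ} (hz : ‖z‖ < 1) : 0 < (1 - (starRingEnd ℂ) (ζ:ℂ) * z).re := by
  have := Complex.re_le_norm ((starRingEnd ℂ) (ζ:ℂ) * z)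
  simp only [norm_mul, RCLike.norm_conj, TT_norm, one_mul] at this
  simp only [sub_re, one_re]
  linarith

lemma one_sub_ne (ζ : TT) {z : ℂ} (hz : ‖z‖ < 1) : (1 - (starRingEnd ℂ) (ζ:ℂ) * z) ≠ 0 := by
  intro h
  have := one_sub_re ζ hz
  simp [h] at this

lemma KK_norm (ζ : TT) (z : ℂ) : ‖KK ζ z‖ = 1 / ‖1 - (starRingEnd ℂ) (ζ:ℂ) * z‖ := by
  simp [KK, TT_norm]

lemma LL_eq (ζ : TT) {z : ℂ} (hz : ‖z‖ < 1) :
    LL ζ z = - Complex.log (1 - (starRingEnd ℂ) (ζ:ℂ) * z) := by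
  unfold LL
  rw [one_div, Complex.log_inv]
  have := one_sub_re ζ hz
  intro h
  rw [Complex.arg_eq_pi_iff] at h
  linarith [h.1]

lemma LL_deriv (ζ : TT) {z : ℂ} (hz : ‖z‖ < 1) : HasDerivAt (LL ζ) (KK ζ z) z := by
  have h1 : HasDerivAt (fun z => - Complex.log (1 - (starRingEnd ℂ) (ζ:ℂ) * z)) (KK ζ z) z := by
    have h2 : HasDerivAt (fun z => (1 - (starRingEnd ℂ) (ζ:ℂ) * z)) (-((starRingEnd ℂ) (ζ:ℂ))) z := by
      simpa using ((hasDerivAt_id z).const_mul ((starRingEnd ℂ) (ζ:ℂ))).const_sub 1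
    have h3 := (h2.clog (Or.inl (one_sub_re ζ hz))).neg
    have h4 : KK ζ z = -(-((starRingEnd ℂ) (ζ:ℂ)) / (1 - (starRingEnd ℂ) (ζ:ℂ) * z)) := by
      rw [neg_div, neg_neg]; rfl
    rw [h4]
    exact h3
  refine h1.congr_of_eventuallyEq ?_
  filter_upwards [(isOpen_lt continuous_norm continuous_const).mem_nhds hz] with w hw
  exact LL_eq ζ hw

lemma KK_cont {Y : Type*} [TopologicalSpace Y] (a : Y → TT) (b : Y → ℂ) (ha : Continuous a)
    (hb : Continuous b) (hb1 : ∀ y, ‖b y‖ < 1) : Continuous (fun y => KK (a y) (b y)) := by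
  unfold KK
  refine Continuous.div (by fun_prop) (by fun_prop) fun y => one_sub_ne _ (hb1 y)

lemma LL_cont {Y : Type*} [TopologicalSpace Y] (a : Y → TT) (b : Y → ℂ) (ha : Continuous a)
    (hb : Continuous b) (hb1 : ∀ y, ‖b y‖ < 1) : Continuous (fun y => LL (a y) (b y)) := by
  have : (fun y => LL (a y) (b y)) =
      fun y => - Complex.log (1 - (starRingEnd ℂ) ((a y : TT):ℂ) * b y) := by
    ext y; exact LL_eq _ (hb1 y)
  rw [this]
  exact (Continuous.clog (by fun_prop) fun y => Or.inl (one_sub_re _ (hb1 y))).neg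

lemma int_bdd (ν : Measure TT) [IsFiniteMeasure ν]
    (φ w : TT → ℂ) (hφ : Continuous φ) (hw : Measurable w) (hw1 : ∃ B, ∀ ζ, ‖w ζ‖ ≤ B) :
    Integrable (fun ζ => φ ζ * w ζ) ν := by
  obtain ⟨A, hA⟩ := (isCompact_univ (X := TT)).exists_bound_of_continuousOn hφ.continuousOn
  obtain ⟨B, hB⟩ := hw1
  refine Integrable.of_bound (hφ.measurable.mul hw).aestronglyMeasurable (A * B)
      (Eventually.of_forall fun x => ?_)
  rw [norm_mul]
  have := hA x (mem_univ _)
  exact mul_le_mul this (hB x) (norm_nonneg _) ((norm_nonneg _).trans this)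

lemma LLint_deriv (ν : Measure TT) [IsFiniteMeasure ν] (w : TT → ℂ) (hw : Measurable w)
    {B : ℝ} (hw1 : ∀ ζ, ‖w ζ‖ ≤ B) {z : ℂ} (hz : ‖z‖ < 1) :
    HasDerivAt (fun z => ∫ ζ, LL ζ z * w ζ ∂ν) (∫ ζ, KK ζ z * w ζ ∂ν) z := by
  have hcs : ∀ z : ℂ, ‖z‖ < 1 → Continuous fun ζ => LL ζ z := fun z hz =>
    LL_cont _ _ continuous_id continuous_const fun _ => hz
  have hck : ∀ z : ℂ, ‖z‖ < 1 → Continuous fun ζ => KK ζ z := fun z hz =>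
    KK_cont _ _ continuous_id continuous_const fun _ => hz
  set ρ := (1 + ‖z‖) / 2 with hρ
  have hρ1 : ρ < 1 := by rw [hρ]; linarith
  have hb : ball (0:ℂ) ρ ∈ 𝓝 z := isOpen_ball.mem_nhds (by simp [hρ]; linarith)
  refine (hasDerivAt_integral_of_dominated_loc_of_deriv_le (bound := fun _ => 1 / (1 - ρ) * B)
    (F := fun z ζ => LL ζ z * w ζ)
    (F' := fun z ζ => KK ζ z * w ζ) hb ?_ ?_ ?_ ?_ ?_ ?_).2
  · filter_upwards [hb] with x hx
    have : ‖x‖ < ρ := by simpa using hx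
    exact ((hcs x (this.trans hρ1)).measurable.mul hw).aestronglyMeasurable
  · exact int_bdd ν _ w (hcs z hz) hw ⟨B, hw1⟩
  · exact ((hck z hz).measurable.mul hw).aestronglyMeasurable
  · refine Eventually.of_forall fun ζ x hx => ?_
    have : ‖x‖ < ρ := by simpa using hx
    rw [norm_mul, KK_norm]
    have h2 := one_sub_norm ζ x
    have h3 : 0 < 1 - ρ := by linarith
    refine mul_le_mul ?_ (hw1 ζ) (norm_nonneg _) (by positivity)
    apply one_div_le_one_div_of_le <;> linarith
  · exact integrable_const _
  · refine Eventually.of_forall fun ζ x hx => ?_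
    have : ‖x‖ < ρ := by simpa using hx
    exact (LL_deriv ζ (this.trans hρ1)).mul_const _

lemma circ_shift (F : ℂ → ℝ) (ζ : TT) :
    ∫ t in (-Real.pi)..Real.pi, F ((ζ:ℂ) * Complex.exp (Complex.I * t)) =
      ∫ θ in (0:ℝ)..(2 * Real.pi), F (Complex.exp (Complex.I * θ)) := by
  set φ := Complex.arg (ζ:ℂ) with hφ
  have h0 : (ζ:ℂ) = Complex.exp (Complex.I * φ) := by
    have := Complex.norm_mul_exp_arg_mul_I (ζ:ℂ)
    rw [TT_norm] at this
    rw [mul_comm, ← this]; simp [hφ]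
  have hper : Function.Periodic (fun θ : ℝ => F (Complex.exp (Complex.I * θ))) (2 * Real.pi) := by
    intro θ
    simp only
    congr 1
    push_cast
    rw [mul_add, Complex.exp_add, show Complex.I * (2 * (Real.pi:ℂ)) = 2 * Real.pi * Complex.I by ring,
      Complex.exp_two_pi_mul_I, mul_one]
  have h1 : ∀ t : ℝ, F ((ζ:ℂ) * Complex.exp (Complex.I * t)) =
      (fun θ : ℝ => F (Complex.exp (Complex.I * θ))) (φ + t) := by
    intro t
    simp only
    rw [h0, ← Complex.exp_add]; push_cast; ring_nf
  simp_rw [h1]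
  rw [intervalIntegral.integral_comp_add_left (fun θ : ℝ => F (Complex.exp (Complex.I * θ)))]
  have h2 := hper.intervalIntegral_add_eq (φ + -Real.pi) 0
  rw [zero_add] at h2
  rw [← h2]
  congr 1; ring

lemma abs_rpow_int {s : ℝ} (hs : -1 < s) :
    IntervalIntegrable (fun t : ℝ => |t| ^ s) volume (-Real.pi) Real.pi := by
  have h1 : IntervalIntegrable (fun t : ℝ => |t| ^ s) volume 0 Real.pi := by
    refine (intervalIntegral.intervalIntegrable_rpow' (a := 0) (b := Real.pi) hs).congr ?_
    intro t ht
    rw [uIoc_of_le Real.pi_pos.le] at ht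
    simp [abs_of_pos ht.1]
  have h2 : IntervalIntegrable (fun t : ℝ => |t| ^ s) volume (-Real.pi) 0 := by
    have := (IntervalIntegrable.iff_comp_neg).1 h1
    simp only [abs_neg, neg_zero] at this
    exact this.symm
  exact h2.trans h1

lemma lower_bd {r t : ℝ} (hr : 1/4 ≤ r) (ht : |t| ≤ Real.pi) :
    |t| / Real.pi ≤ ‖1 - (r:ℂ) * Complex.exp (Complex.I * t)‖ := by
  have hpi := Real.pi_pos
  have h1 : ‖1 - (r:ℂ) * Complex.exp (Complex.I * t)‖ ^ 2 = (1 - r)^2 + 4 * r * Real.sin (t/2)^2 := by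
    rw [mul_comm Complex.I, Complex.exp_mul_I, ← Complex.normSq_eq_norm_sq, Complex.normSq_apply]
    simp only [sub_re, one_re, mul_re, ofReal_re, add_re, cos_ofReal_re, sin_ofReal_re, I_re,
      mul_zero, sin_ofReal_im, I_im, ofReal_im, add_im, cos_ofReal_im, mul_im, zero_mul, sub_im,
      one_im, mul_one, sub_zero, add_zero, zero_add]
    have h3 : Real.cos t = 1 - 2 * Real.sin (t/2)^2 := by
      have := Real.cos_two_mul (t/2)
      rw [mul_div_cancel₀ _ (two_ne_zero)] at this
      nlinarith [Real.sin_sq_add_cos_sq (t/2)]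
    have h4 := Real.sin_sq_add_cos_sq t
    have : Real.sin t ^ 2 = 1 - Real.cos t ^ 2 := by linarith
    ring_nf
    rw [this, h3]; ring
  have h2 : |t| / Real.pi ≤ |Real.sin (t/2)| := by
    have := Real.mul_le_sin (x := |t|/2) (by positivity) (by linarith)
    have h5 : Real.sin (|t|/2) ≤ |Real.sin (t/2)| := by
      rcases abs_cases t with ⟨h, _⟩ | ⟨h, _⟩
      · rw [h]; exact le_abs_self _
      · rw [h, neg_div, Real.sin_neg]; exact neg_le_abs _
    calc |t| / Real.pi = 2 / Real.pi * (|t|/2) := by field_simp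
      _ ≤ _ := this.trans h5
  apply le_of_sq_le_sq _ (norm_nonneg _)
  rw [h1]
  have h6 : (|t| / Real.pi)^2 ≤ |Real.sin (t/2)|^2 := by gcongr
  rw [sq_abs] at h6
  nlinarith [sq_nonneg (1-r), sq_nonneg (Real.sin (t/2))]

lemma conj_mul_self (ζ : TT) : (starRingEnd ℂ) (ζ:ℂ) * (ζ:ℂ) = 1 := by
  rw [mul_comm, Complex.mul_conj, Complex.normSq_eq_norm_sq, TT_norm]; simp

lemma pt_norm (ζ : TT) {r : ℝ} (hr : 0 ≤ r) (t : ℝ) :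
    ‖(r:ℂ) * ((ζ:ℂ) * Complex.exp (Complex.I * t))‖ = r := by
  rw [mul_comm Complex.I, norm_mul, norm_mul, TT_norm, Complex.norm_exp_ofReal_mul_I]
  simp [hr]

lemma KK_bd (ζ : TT) {r t : ℝ} (hr : 1/4 ≤ r) (ht : |t| ≤ Real.pi) (ht0 : t ≠ 0) :
    ‖KK ζ ((r:ℂ) * ((ζ:ℂ) * Complex.exp (Complex.I * t)))‖ ≤ Real.pi / |t| := by
  rw [KK_norm]
  have : (starRingEnd ℂ) (ζ:ℂ) * ((r:ℂ) * ((ζ:ℂ) * Complex.exp (Complex.I * t))) =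
      (r:ℂ) * Complex.exp (Complex.I * t) := by
    linear_combination (r:ℂ) * Complex.exp (Complex.I * t) * conj_mul_self ζ
  rw [this]
  have h := lower_bd hr ht
  have hp : 0 < |t| / Real.pi := div_pos (abs_pos.2 ht0) Real.pi_pos
  rw [← one_div_div |t| Real.pi]
  exact one_div_le_one_div_of_le hp h

lemma LL_bd (ζ : TT) {r t ε : ℝ} (hε : 0 < ε) (hr : 1/4 ≤ r) (hr1 : r < 1)
    (ht : |t| ≤ Real.pi) (ht0 : t ≠ 0) :
    ‖LL ζ ((r:ℂ) * ((ζ:ℂ) * Complex.exp (Complex.I * t)))‖ ≤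
      (1 + Real.pi + 1 / ε) * (Real.pi / |t|) ^ ε := by
  have hpi := Real.pi_pos
  have hta : 0 < |t| := abs_pos.2 ht0
  have hz := pt_norm ζ (by linarith : 0 ≤ r) t
  set z := (r:ℂ) * ((ζ:ℂ) * Complex.exp (Complex.I * t)) with hzdef
  have hK := KK_bd ζ hr ht ht0
  rw [← hzdef, KK_norm] at hK
  rw [LL_eq ζ (by rw [hz]; exact hr1), norm_neg]
  set y := 1 - (starRingEnd ℂ) (ζ:ℂ) * z with hy
  have hy0 : 0 < ‖y‖ := norm_pos_iff.2 (one_sub_ne ζ (by rw [hz]; exact hr1))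
  have hy2 : ‖y‖ ≤ 2 := by
    refine (norm_sub_le _ _).trans ?_
    simp [hz]; linarith
  have h1 : 1 ≤ (Real.pi / |t|) ^ ε :=
    Real.one_le_rpow ((one_le_div hta).2 ht) hε.le
  have h2 : |Real.log ‖y‖| ≤ 1 + (Real.pi / |t|) ^ ε / ε := by
    have hpos : 0 ≤ (Real.pi / |t|) ^ ε / ε := by positivity
    rw [abs_le]
    constructor
    · have h3 := Real.log_le_rpow_div (x := 1/‖y‖) (by positivity) hε
      have h4 : (1/‖y‖) ^ ε ≤ (Real.pi / |t|) ^ ε :=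
        Real.rpow_le_rpow (by positivity) hK hε.le
      have h5 : (1/‖y‖) ^ ε / ε ≤ (Real.pi / |t|) ^ ε / ε := by gcongr
      rw [one_div, Real.log_inv, ← one_div] at h3
      linarith
    · have := Real.log_le_sub_one_of_pos hy0
      linarith
  have h3 : ‖Complex.log y‖ ≤ |Real.log ‖y‖| + Real.pi := by
    refine (Complex.norm_le_abs_re_add_abs_im _).trans ?_
    rw [Complex.log_re, Complex.log_im]
    gcongr
    exact Complex.abs_arg_le_pi y
  have : (1 + Real.pi + 1 / ε) * (Real.pi / |t|) ^ ε =
    (1 + Real.pi) * (Real.pi / |t|) ^ ε + (Real.pi / |t|) ^ ε / ε := by ring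
  rw [this]
  nlinarith

lemma split_le {x s p : ℝ} (hx : 0 ≤ x) (hs : 0 < s) (hp : 1 < p) :
    x ≤ s ^ ((p-1)/2) * x ^ p + s ^ (-(1/2):ℝ) := by
  by_cases h : x ≤ s ^ (-(1/2):ℝ)
  · have : 0 ≤ s ^ ((p-1)/2) * x ^ p := by positivity
    linarith
  · push Not at h
    have h0 : 0 < s ^ (-(1/2):ℝ) := by positivity
    have hx0 : 0 < x := h0.trans h
    have h1 : (s ^ (-(1/2):ℝ)) ^ (p-1) ≤ x ^ (p-1) := Real.rpow_le_rpow h0.le h.le (by linarith)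
    have h2 : s ^ ((p-1)/2) * (s ^ (-(1/2):ℝ)) ^ (p-1) = 1 := by
      rw [← Real.rpow_mul hs.le, ← Real.rpow_add hs]
      convert Real.rpow_zero s using 2; ring
    have h3 : x ^ p = x ^ (p-1) * x := by
      rw [← Real.rpow_add_one hx0.ne']; congr 1; ring
    have h4 : 1 ≤ s ^ ((p-1)/2) * x ^ (p-1) := by
      exact h2.symm.le.trans (mul_le_mul_of_nonneg_left h1 (by positivity))
    rw [h3, ← mul_assoc]
    nlinarith

lemma pt_cont (ζ : TT) (r : ℝ) :
    Continuous (fun t : ℝ => (r:ℂ) * ((ζ:ℂ) * Complex.exp (Complex.I * t))) := by fun_prop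

lemma comp_cont {Y : Type*} [TopologicalSpace Y] {F : ℂ → ℂ} (hF : DifferentiableOn ℂ F (ball 0 1))
    (b : Y → ℂ) (hb : Continuous b) (hb1 : ∀ y, ‖b y‖ < 1) : Continuous (fun y => F (b y)) :=
  hF.continuousOn.comp_continuous hb fun y => by simpa using hb1 y

lemma deriv_shift {f : ℂ → ℂ} {p C : ℝ} 
    (hC : ∀ r : ℝ, 0 ≤ r → r < 1 →
      ∫ θ in (0:ℝ)..(2 * Real.pi), ‖deriv f ((r : ℂ) * Complex.exp (Complex.I * θ))‖ ^ p ≤ C)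
    (ζ : TT) {r : ℝ} (hr : 0 ≤ r) (hr1 : r < 1) :
    ∫ t in (-Real.pi)..Real.pi,
      ‖deriv f ((r:ℂ) * ((ζ:ℂ) * Complex.exp (Complex.I * t)))‖ ^ p ≤ C := by
  rw [circ_shift (fun w => ‖deriv f ((r:ℂ) * w)‖ ^ p) ζ]
  exact hC r hr hr1

lemma osc_bd {f : ℂ → ℂ} (hf : DifferentiableOn ℂ f (ball 0 1)) {p C : ℝ} (hp : 1 < p)
    (hC : ∀ r : ℝ, 0 ≤ r → r < 1 →
      ∫ θ in (0:ℝ)..(2 * Real.pi), ‖deriv f ((r : ℂ) * Complex.exp (Complex.I * θ))‖ ^ p ≤ C)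
    (ζ : TT) {r t : ℝ} (hr : 0 ≤ r) (hr1 : r < 1) (ht : |t| ≤ Real.pi) (ht0 : t ≠ 0) :
    ‖f ((r:ℂ) * ((ζ:ℂ) * Complex.exp (Complex.I * t))) - f ((r:ℂ) * ζ)‖ ≤
      C * |t| ^ ((p-1)/2) + |t| ^ (1/2:ℝ) := by
  have hta : 0 < |t| := abs_pos.2 ht0
  set z : ℝ → ℂ := fun t => (r:ℂ) * ((ζ:ℂ) * Complex.exp (Complex.I * t)) with hz
  have hzc : Continuous z := pt_cont ζ r
  have hz1 : ∀ t, ‖z t‖ < 1 := fun t => by rw [hz, pt_norm ζ hr]; exact hr1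
  have hdz : ∀ s : ℝ, HasDerivAt z (z s * Complex.I) s := by
    intro s
    have h1 : HasDerivAt (fun s : ℝ => Complex.I * (s:ℂ)) Complex.I s := by
      simpa using (Complex.ofRealCLM.hasDerivAt (x := s)).const_mul Complex.I
    have h2 := ((h1.cexp).const_mul (ζ:ℂ)).const_mul (r:ℂ)
    simpa [hz, mul_assoc] using h2
  have hd : DifferentiableOn ℂ (deriv f) (ball 0 1) := hf.deriv isOpen_ball
  have hfd : ∀ s : ℝ, HasDerivAt (fun s => f (z s)) (deriv f (z s) * (z s * Complex.I)) s := by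
    intro s
    have h1 : HasDerivAt f (deriv f (z s)) (z s) :=
      (hf.differentiableAt (isOpen_ball.mem_nhds (by simpa using hz1 s))).hasDerivAt
    exact h1.comp s (hdz s)
  have hdc : Continuous (fun s => deriv f (z s)) := comp_cont hd z hzc hz1
  have hu : Continuous (fun s => ‖deriv f (z s)‖ ^ p) :=
    hdc.norm.rpow_const fun _ => Or.inr (by linarith)
  have hint : ∫ s in (0:ℝ)..t, deriv f (z s) * (z s * Complex.I) = f (z t) - f (z 0) :=
    intervalIntegral.integral_eq_sub_of_hasDerivAt (fun s _ => hfd s)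
      (Continuous.intervalIntegrable (by fun_prop) _ _)
  have hz0 : z 0 = r * ζ := by simp [hz]
  rw [← hz0, ← hint]
  refine (intervalIntegral.norm_integral_le_integral_norm_uIoc).trans ?_
  have hsub : uIoc 0 t ⊆ Ioc (-Real.pi) Real.pi := by
    have := abs_le.1 ht
    intro s hs
    rw [mem_uIoc] at hs
    rcases hs with hs | hs
    · exact ⟨by linarith [Real.pi_pos, hs.1], by linarith [hs.2]⟩
    · exact ⟨by linarith [Real.pi_pos, hs.1], by linarith [hs.2, Real.pi_pos]⟩
  have hi1 : IntegrableOn (fun s => ‖deriv f (z s)‖ ^ p) (Ioc (-Real.pi) Real.pi) :=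
    hu.integrableOn_Ioc
  calc ∫ s in uIoc 0 t, ‖deriv f (z s) * (z s * Complex.I)‖
      ≤ ∫ s in uIoc 0 t, (|t| ^ ((p-1)/2) * ‖deriv f (z s)‖ ^ p + |t| ^ (-(1/2):ℝ)) := by
        refine setIntegral_mono_on ?_ ?_ measurableSet_uIoc fun s _ => ?_
        · exact (Continuous.integrableOn_uIoc (by fun_prop))
        · exact (Continuous.integrableOn_uIoc (by fun_prop))
        · refine le_trans ?_ (split_le (norm_nonneg _) hta hp)
          rw [norm_mul, norm_mul, Complex.norm_I, mul_one]
          exact mul_le_of_le_one_right (norm_nonneg _) (hz1 s).le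
    _ = |t| ^ ((p-1)/2) * (∫ s in uIoc 0 t, ‖deriv f (z s)‖ ^ p) + |t| * |t| ^ (-(1/2):ℝ) := by
        rw [integral_add, integral_const_mul, setIntegral_const]
        · congr 1
          rw [smul_eq_mul]
          congr 1
          rw [measureReal_def, Real.volume_uIoc]; simp
        · exact (Continuous.integrableOn_uIoc (by fun_prop))
        · exact (Continuous.integrableOn_uIoc (by fun_prop))
    _ ≤ |t| ^ ((p-1)/2) * C + |t| ^ (1/2:ℝ) := by
        have h1 : ∫ s in uIoc 0 t, ‖deriv f (z s)‖ ^ p ≤ C := by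
          refine le_trans ?_ (deriv_shift hC ζ hr hr1)
          rw [intervalIntegral.integral_of_le (by linarith [Real.pi_pos])]
          exact setIntegral_mono_set hi1 (Eventually.of_forall fun s => by positivity)
            hsub.eventuallyLE
        have h2 : |t| * |t| ^ (-(1/2):ℝ) = |t| ^ (1/2:ℝ) := by
          conv_lhs => rw [← Real.rpow_one |t|, ← Real.rpow_mul hta.le, ← Real.rpow_add hta]
          norm_num
        rw [h2]
        gcongr
    _ = _ := by ring

lemma f_bd {f : ℂ → ℂ} (hf : DifferentiableOn ℂ f (ball 0 1)) {p C : ℝ} (hp : 1 < p)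
    (hC : ∀ r : ℝ, 0 ≤ r → r < 1 →
      ∫ θ in (0:ℝ)..(2 * Real.pi), ‖deriv f ((r : ℂ) * Complex.exp (Complex.I * θ))‖ ^ p ≤ C)
    (ζ : TT) {r : ℝ} (hr : 0 < r) (hr1 : r < 1) :
    ‖f ((r:ℂ) * ζ)‖ ≤ ‖f 0‖ + (|C| * Real.pi ^ ((p-1)/2) + Real.pi ^ (1/2:ℝ)) := by
  set B := |C| * Real.pi ^ ((p-1)/2) + Real.pi ^ (1/2:ℝ) with hB
  have hpi := Real.pi_pos
  have hB0 : 0 ≤ B := by positivity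
  have h1 : ∀ z ∈ frontier (ball (0:ℂ) r), ‖f z - f (r * ζ)‖ ≤ B := by
    intro z hz
    rw [frontier_ball _ hr.ne'] at hz
    have hzr : ‖z‖ = r := by simpa using hz
    set w := z / (r * ζ) with hw
    have hζ0 : (ζ:ℂ) ≠ 0 := norm_ne_zero_iff.1 (by rw [TT_norm]; exact one_ne_zero)
    have hr0 : (r:ℂ) ≠ 0 := by exact_mod_cast hr.ne'
    have hwn : ‖w‖ = 1 := by
      rw [hw, norm_div, norm_mul, TT_norm, hzr]; simp [abs_of_pos hr, hr.ne']
    have hwe : w = Complex.exp (Complex.I * (Complex.arg w : ℝ)) := by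
      have := Complex.norm_mul_exp_arg_mul_I w
      rw [hwn] at this
      rw [mul_comm]; simpa using this.symm
    have hzw : z = (r:ℂ) * ((ζ:ℂ) * w) := by rw [hw]; field_simp
    by_cases h0 : Complex.arg w = 0
    · rw [h0] at hwe
      have : w = 1 := by simpa using hwe
      rw [hzw, this]; simpa using hB0
    · rw [hzw]
      rw [hwe]
      refine (osc_bd hf hp hC ζ hr.le hr1 (Complex.abs_arg_le_pi w) h0).trans ?_
      rw [hB]
      have := Complex.abs_arg_le_pi w
      have e1 : |w.arg| ^ ((p-1)/2) ≤ Real.pi ^ ((p-1)/2) :=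
        Real.rpow_le_rpow (abs_nonneg _) this (by linarith)
      have e2 : |w.arg| ^ (1/2:ℝ) ≤ Real.pi ^ (1/2:ℝ) :=
        Real.rpow_le_rpow (abs_nonneg _) this (by norm_num)
      have e3 : C * |w.arg| ^ ((p-1)/2) ≤ |C| * Real.pi ^ ((p-1)/2) :=
        mul_le_mul (le_abs_self _) e1 (by positivity) (abs_nonneg _)
      linarith
  have h2 : DiffContOnCl ℂ (fun z => f z - f (r * ζ)) (ball 0 r) := by
    apply DifferentiableOn.diffContOnCl
    rw [closure_ball _ hr.ne']
    exact (hf.mono (closedBall_subset_ball hr1)).sub_const _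
  have h3 := Complex.norm_le_of_forall_mem_frontier_norm_le isBounded_ball h2 h1
    (subset_closure (mem_ball_self hr))
  have h4 := norm_sub_norm_le (f (r * ζ)) (f 0)
  rw [norm_sub_rev] at h4
  linarith

/-- the integrand to be bounded -/
def BB (f : ℂ → ℂ) (r : ℝ) (ζ : TT) (w : ℂ) : ℝ :=
  ‖deriv f ((r:ℂ) * w)‖ * ‖LL ζ ((r:ℂ) * w)‖ + ‖f ((r:ℂ) * w) - f ((r:ℂ) * ζ)‖ * ‖KK ζ ((r:ℂ) * w)‖

lemma BB_cont {Y : Type*} [TopologicalSpace Y] {f : ℂ → ℂ}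
    (hf : DifferentiableOn ℂ f (ball 0 1)) {r : ℝ} (hr : 0 ≤ r) (hr1 : r < 1)
    (a : Y → TT) (b : Y → ℂ) (ha : Continuous a) (hb : Continuous b) (hb1 : ∀ y, ‖b y‖ = 1) :
    Continuous (fun y => BB f r (a y) (b y)) := by
  have hn : ∀ y, ‖(r:ℂ) * b y‖ < 1 := fun y => by
    rw [norm_mul, hb1]; simpa [abs_of_nonneg hr] using hr1
  have hn' : ∀ y, ‖(r:ℂ) * (a y : ℂ)‖ < 1 := fun y => by
    rw [norm_mul, TT_norm]; simpa [abs_of_nonneg hr] using hr1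
  have hc : Continuous (fun y => (r:ℂ) * b y) := by fun_prop
  have hc' : Continuous (fun y => (r:ℂ) * (a y : ℂ)) := by fun_prop
  have hd : DifferentiableOn ℂ (deriv f) (ball 0 1) := hf.deriv isOpen_ball
  exact ((comp_cont hd _ hc hn).norm.mul (LL_cont a _ ha hc hn).norm).add
    (((comp_cont hf _ hc hn).sub (comp_cont hf _ hc' hn')).norm.mul (KK_cont a _ ha hc hn).norm)

lemma exp_norm (θ : ℝ) : ‖Complex.exp (Complex.I * θ)‖ = 1 := by
  rw [mul_comm, Complex.norm_exp_ofReal_mul_I]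

lemma BB_int {f : ℂ → ℂ} (hf : DifferentiableOn ℂ f (ball 0 1)) {p C : ℝ} (hp : 1 < p)
    (hC : ∀ r : ℝ, 0 ≤ r → r < 1 →
      ∫ θ in (0:ℝ)..(2 * Real.pi), ‖deriv f ((r : ℂ) * Complex.exp (Complex.I * θ))‖ ^ p ≤ C) :
    ∃ C' : ℝ, ∀ (ζ : TT) (r : ℝ), 1/4 ≤ r → r < 1 →
      ∫ θ in (0:ℝ)..(2 * Real.pi), BB f r ζ (Complex.exp (Complex.I * θ)) ≤ C' := by
  have hpi := Real.pi_pos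
  set q := p / (p - 1) with hq
  have hpq : p.HolderConjugate q := Real.HolderConjugate.conjExponent hp
  have hq1 : 1 < q := hpq.symm.lt
  set ε := 1 / (2 * q) with hε
  have hε0 : 0 < ε := by positivity
  set A := (1 + Real.pi + 1/ε) ^ q * Real.pi ^ (1/2:ℝ) with hA
  have hA0 : 0 ≤ A := by positivity
  set Φ : ℝ → ℝ := fun t => (A + Real.pi) * |t| ^ (-(1/2):ℝ) + Real.pi * C * |t| ^ ((p-1)/2 - 1) with hΦ
  have hΦi : IntervalIntegrable Φ volume (-Real.pi) Real.pi :=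
    ((abs_rpow_int (by norm_num)).const_mul _).add ((abs_rpow_int (by linarith)).const_mul _)
  refine ⟨C + ∫ t in (-Real.pi)..Real.pi, Φ t, fun ζ r hr hr1 => ?_⟩
  have hr0 : 0 ≤ r := by linarith
  rw [← circ_shift (fun w => BB f r ζ w) ζ]
  have hn : ∀ t : ℝ, ‖(ζ:ℂ) * Complex.exp (Complex.I * t)‖ = 1 := fun t => by
    rw [norm_mul, TT_norm, exp_norm, one_mul]
  have hBc : Continuous (fun t : ℝ => BB f r ζ ((ζ:ℂ) * Complex.exp (Complex.I * t))) :=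
    BB_cont hf hr0 hr1 (fun _ => ζ) _ continuous_const (by fun_prop) hn
  have hd : DifferentiableOn ℂ (deriv f) (ball 0 1) := hf.deriv isOpen_ball
  have hu : Continuous (fun t : ℝ => ‖deriv f ((r:ℂ) * ((ζ:ℂ) * Complex.exp (Complex.I * t)))‖ ^ p) :=
    (comp_cont hd _ (pt_cont ζ r) (fun t => by rw [pt_norm ζ hr0]; exact hr1)).norm.rpow_const
      fun _ => Or.inr (by linarith)
  have hui := hu.intervalIntegrable (μ := volume) (-Real.pi) Real.pi
  calc ∫ t in (-Real.pi)..Real.pi, BB f r ζ ((ζ:ℂ) * Complex.exp (Complex.I * t))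
      ≤ ∫ t in (-Real.pi)..Real.pi,
        (‖deriv f ((r:ℂ) * ((ζ:ℂ) * Complex.exp (Complex.I * t)))‖ ^ p + Φ t) := by
        apply intervalIntegral.integral_mono_ae_restrict (by linarith)
          (hBc.intervalIntegrable _ _) (hui.add hΦi)
        have h0 : ∀ᵐ t : ℝ, t ≠ 0 := by
          simp [ae_iff]
        filter_upwards [ae_restrict_of_ae h0, ae_restrict_mem measurableSet_Icc] with t ht0 htm
        have ht : |t| ≤ Real.pi := abs_le.2 htm
        have hta : 0 < |t| := abs_pos.2 ht0
        have hL := LL_bd ζ hε0 hr hr1 ht ht0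
        have hK := KK_bd ζ hr ht ht0
        have hO := osc_bd hf hp hC ζ hr0 hr1 ht ht0
        unfold BB
        set x := ‖deriv f ((r:ℂ) * ((ζ:ℂ) * Complex.exp (Complex.I * t)))‖ with hx
        set l := ‖LL ζ ((r:ℂ) * ((ζ:ℂ) * Complex.exp (Complex.I * t)))‖ with hl
        have hx0 : 0 ≤ x := norm_nonneg _
        have hl0 : 0 ≤ l := norm_nonneg _
        have y1 : x * l ≤ x ^ p + A * |t| ^ (-(1/2):ℝ) := by
          have y := Real.young_inequality_of_nonneg hx0 hl0 hpq
          have y2 : x ^ p / p ≤ x ^ p := div_le_self (by positivity) hp.le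
          have y3 : l ^ q / q ≤ l ^ q := div_le_self (by positivity) hq1.le
          have y4 : l ^ q ≤ A * |t| ^ (-(1/2):ℝ) := by
            refine (Real.rpow_le_rpow hl0 hL (by linarith)).trans (le_of_eq ?_)
            rw [Real.mul_rpow (by positivity) (by positivity), ← Real.rpow_mul (by positivity)]
            have : ε * q = 1/2 := by rw [hε]; field_simp
            rw [this, Real.div_rpow hpi.le hta.le, Real.rpow_neg hta.le, hA]
            ring
          linarith
        have y5 : ‖f ((r:ℂ) * ((ζ:ℂ) * Complex.exp (Complex.I * t))) - f ((r:ℂ) * ζ)‖ *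
            ‖KK ζ ((r:ℂ) * ((ζ:ℂ) * Complex.exp (Complex.I * t)))‖ ≤
            Real.pi * |t| ^ (-(1/2):ℝ) + Real.pi * C * |t| ^ ((p-1)/2 - 1) := by
          refine (mul_le_mul hO hK (norm_nonneg _) ((norm_nonneg _).trans hO)).trans (le_of_eq ?_)
          have e1 : |t| ^ (-(1/2):ℝ) = |t| ^ (1/2:ℝ) / |t| := by
            rw [← Real.rpow_sub_one hta.ne']; norm_num
          rw [e1, Real.rpow_sub_one hta.ne']
          field_simp
          ring
        simp only [hΦ]
        linarith
    _ = (∫ t in (-Real.pi)..Real.pi,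
        ‖deriv f ((r:ℂ) * ((ζ:ℂ) * Complex.exp (Complex.I * t)))‖ ^ p) +
        ∫ t in (-Real.pi)..Real.pi, Φ t := intervalIntegral.integral_add hui hΦi
    _ ≤ _ := by
        gcongr
        exact deriv_shift hC ζ hr0 hr1

lemma cauchy_rep {G : ℂ → ℂ} (hG : DifferentiableOn ℂ G (closedBall 0 1)) {z : ℂ} (hz : ‖z‖ < 1)
    (e : ℝ → TT) (he : ∀ θ : ℝ, (e θ : ℂ) = Complex.exp (Complex.I * θ)) :
    ∫ θ in Ioc (0:ℝ) (2 * Real.pi), KK (e θ) z *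
      ((1 / (2 * Real.pi)) * (Complex.exp (Complex.I * θ) * G (Complex.exp (Complex.I * θ)))) = G z := by
  have h := hG.circleIntegral_sub_inv_smul (w := z) (by simpa using hz)
  have hpi : (Real.pi : ℂ) ≠ 0 := by exact_mod_cast Real.pi_ne_zero
  rw [circleIntegral, intervalIntegral.integral_of_le (by positivity)] at h
  have key : ∀ θ : ℝ, KK (e θ) z *
      ((1 / (2 * Real.pi)) * (Complex.exp (Complex.I * θ) * G (Complex.exp (Complex.I * θ)))) =
      (1 / (2 * Real.pi * Complex.I)) * (deriv (circleMap 0 1) θ • ((circleMap 0 1 θ - z)⁻¹ • G (circleMap 0 1 θ))) := by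
    intro θ
    have hc : circleMap 0 1 θ = Complex.exp (Complex.I * θ) := by simp [circleMap, mul_comm]
    rw [deriv_circleMap, hc]
    set x := Complex.exp (Complex.I * θ) with hx
    have hx1 : ‖x‖ = 1 := exp_norm θ
    have hx0 : x ≠ 0 := norm_ne_zero_iff.1 (by rw [hx1]; exact one_ne_zero)
    have hxz : x - z ≠ 0 := by
      intro h0
      rw [sub_eq_zero] at h0
      rw [← h0, hx1] at hz
      exact lt_irrefl _ hz
    have hconj : (starRingEnd ℂ) x = x⁻¹ := by
      rw [Complex.inv_def, Complex.normSq_eq_norm_sq, hx1]; simp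
    have hK : KK (e θ) z = 1 / (x - z) := by
      unfold KK
      rw [he, ← hx, hconj]
      have : 1 - x⁻¹ * z = x⁻¹ * (x - z) := by field_simp
      rw [this]
      field_simp
    rw [hK]
    simp only [smul_eq_mul]
    have hI := Complex.I_ne_zero
    field_simp
  simp_rw [key]
  rw [integral_const_mul, h, smul_eq_mul]
  have hI := Complex.I_ne_zero
  field_simp

lemma G_bd {f g : ℂ → ℂ} (hf : DifferentiableOn ℂ f (ball 0 1)) {p C : ℝ} (hp : 1 < p)
    (hC : ∀ r : ℝ, 0 ≤ r → r < 1 →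
      ∫ θ in (0:ℝ)..(2 * Real.pi), ‖deriv f ((r : ℂ) * Complex.exp (Complex.I * θ))‖ ^ p ≤ C)
    (ν : Measure TT) [IsFiniteMeasure ν] (w : TT → ℂ) (hw : Measurable w) (hw1 : ∀ ζ, ‖w ζ‖ = 1)
    (hg : ∀ z : ℂ, ‖z‖ < 1 → g z = g 0 + ∫ ζ, LL ζ z * w ζ ∂ν) :
    ∃ C1 : ℝ, ∀ r : ℝ, 1/4 ≤ r → r < 1 → ∀ G : ℂ → ℂ, ContinuousOn G (closedBall 0 1) →
      (∀ z, ‖z‖ ≤ 1 → G z = deriv f (r * z) * g (r * z) +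
        (f (r * z) * (∫ ζ, KK ζ (r * z) * w ζ ∂ν) -
          ∫ ζ, KK ζ (r * z) * (f (r * ζ) * w ζ) ∂ν)) →
      ∫ θ in (0:ℝ)..(2 * Real.pi), ‖G (Complex.exp (Complex.I * θ))‖ ≤ C1 := by
  obtain ⟨C', hC'⟩ := BB_int hf hp hC
  have hpi := Real.pi_pos
  refine ⟨‖g 0‖ * (2 * Real.pi + C) + ∫ ζ, C' ∂ν, fun r hr hr1 G hGc hG => ?_⟩
  have hr0 : 0 ≤ r := by linarith
  have hrc : ∀ z : ℂ, ‖z‖ = 1 → ‖(r:ℂ) * z‖ < 1 := fun z hz => by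
    rw [norm_mul, hz]; simpa [abs_of_nonneg hr0] using hr1
  have hec : Continuous (fun θ : ℝ => Complex.exp (Complex.I * θ)) := by fun_prop
  have hd : DifferentiableOn ℂ (deriv f) (ball 0 1) := hf.deriv isOpen_ball
  have hdc : Continuous (fun θ : ℝ => deriv f (r * Complex.exp (Complex.I * θ))) :=
    comp_cont hd _ (by fun_prop) fun θ => hrc _ (exp_norm θ)
  have hGcc : Continuous (fun θ : ℝ => G (Complex.exp (Complex.I * θ))) :=
    hGc.comp_continuous hec fun θ => by simp [exp_norm]
  have hBcont : Continuous (fun x : ℝ × TT => BB f r x.2 (Complex.exp (Complex.I * x.1))) :=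
    BB_cont hf hr0 hr1 _ _ continuous_snd (by fun_prop) fun x => exp_norm x.1
  have hBint : Integrable (Function.uncurry fun (θ : ℝ) (ζ : TT) => BB f r ζ (Complex.exp (Complex.I * θ)))
      ((volume.restrict (uIoc (0:ℝ) (2 * Real.pi))).prod ν) := by
    obtain ⟨A, hA⟩ := ((isCompact_Icc (a := (0:ℝ)) (b := 2 * Real.pi)).prod
      (isCompact_univ (X := TT))).exists_bound_of_continuousOn hBcont.continuousOn
    rw [uIoc_of_le (by positivity)]
    have hfm : IsFiniteMeasure (volume.restrict (Ioc (0:ℝ) (2 * Real.pi))) := inferInstance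
    refine Integrable.of_bound (hBcont.aestronglyMeasurable) A ?_
    have h1 : ∀ᵐ x ∂((volume.restrict (Ioc (0:ℝ) (2 * Real.pi))).prod ν), x.1 ∈ Ioc (0:ℝ) (2 * Real.pi) :=
      Measure.quasiMeasurePreserving_fst.ae (ae_restrict_mem measurableSet_Ioc)
    filter_upwards [h1] with x hx
    exact hA x ⟨Ioc_subset_Icc_self hx, mem_univ _⟩
  have hBζ : ∀ u : ℂ, ‖u‖ = 1 → Continuous fun ζ : TT => BB f r ζ u := fun u hu =>
    BB_cont hf hr0 hr1 _ _ continuous_id continuous_const fun _ => hu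
  have hpt : ∀ u : ℂ, ‖u‖ = 1 → ‖G u‖ ≤ ‖g 0‖ * ‖deriv f (r * u)‖ + ∫ ζ, BB f r ζ u ∂ν := by
    intro u hu
    have hru := hrc u hu
    have cL : Continuous fun ζ : TT => LL ζ (r * u) := LL_cont _ _ continuous_id continuous_const fun _ => hru
    have cK : Continuous fun ζ : TT => KK ζ (r * u) := KK_cont _ _ continuous_id continuous_const fun _ => hru
    have cf : Continuous fun ζ : TT => f (r * ζ) := comp_cont hf _ (by fun_prop) fun ζ => hrc _ (TT_norm ζ)
    have iL := int_bdd ν _ w cL hw ⟨1, fun ζ => (hw1 ζ).le⟩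
    have iK := int_bdd ν _ w cK hw ⟨1, fun ζ => (hw1 ζ).le⟩
    have iKf := int_bdd ν (fun ζ : TT => KK ζ (r * u) * f (r * ζ)) w (cK.mul cf) hw ⟨1, fun ζ => (hw1 ζ).le⟩
    have e1 : G u = g 0 * deriv f (r * u) +
        ∫ ζ, (deriv f (r * u) * (LL ζ (r * u) * w ζ) + (f (r * u) * (KK ζ (r * u) * w ζ) -
          KK ζ (r * u) * f (r * ζ) * w ζ)) ∂ν := by
      have iD : Integrable (fun ζ => f (r * u) * (KK ζ (r * u) * w ζ) -
          KK ζ (r * u) * f (r * ζ) * w ζ) ν := (iK.const_mul _).sub iKf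
      rw [integral_add (iL.const_mul _) iD,
        integral_sub (iK.const_mul _) iKf, integral_const_mul, integral_const_mul, hG u hu.le, hg _ hru]
      simp only [mul_assoc]
      ring
    rw [e1]
    refine (norm_add_le _ _).trans ?_
    rw [norm_mul]
    gcongr
    refine norm_integral_le_of_norm_le ?_ (Eventually.of_forall fun ζ => ?_)
    · obtain ⟨A, hA⟩ := (isCompact_univ (X := TT)).exists_bound_of_continuousOn (hBζ u hu).continuousOn
      exact Integrable.of_bound (hBζ u hu).aestronglyMeasurable A
        (Eventually.of_forall fun x => hA x (mem_univ _))
    · have : deriv f (r * u) * (LL ζ (r * u) * w ζ) + (f (r * u) * (KK ζ (r * u) * w ζ) -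
          KK ζ (r * u) * f (r * ζ) * w ζ) =
          (deriv f (r * u) * LL ζ (r * u) + (f (r * u) - f (r * ζ)) * KK ζ (r * u)) * w ζ := by ring
      rw [this, norm_mul, hw1, mul_one]
      refine (norm_add_le _ _).trans ?_
      rw [norm_mul, norm_mul]
      rfl
  have hswap := intervalIntegral_integral_swap hBint
  have hi2 : IntervalIntegrable (fun θ : ℝ => ∫ ζ, BB f r ζ (Complex.exp (Complex.I * θ)) ∂ν) volume 0 (2 * Real.pi) := by
    rw [intervalIntegrable_iff]
    exact hBint.integral_prod_left
  have hi1 : IntervalIntegrable (fun θ : ℝ => ‖g 0‖ * ‖deriv f (r * Complex.exp (Complex.I * θ))‖) volume 0 (2 * Real.pi) :=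
    Continuous.intervalIntegrable (by fun_prop) _ _
  have hup : Continuous (fun θ : ℝ => ‖deriv f (r * Complex.exp (Complex.I * θ))‖ ^ p) :=
    hdc.norm.rpow_const fun _ => Or.inr (by linarith)
  calc ∫ θ in (0:ℝ)..(2 * Real.pi), ‖G (Complex.exp (Complex.I * θ))‖
      ≤ ∫ θ in (0:ℝ)..(2 * Real.pi), (‖g 0‖ * ‖deriv f (r * Complex.exp (Complex.I * θ))‖ +
        ∫ ζ, BB f r ζ (Complex.exp (Complex.I * θ)) ∂ν) := by
        apply intervalIntegral.integral_mono (by positivity)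
          (hGcc.norm.intervalIntegrable _ _) (hi1.add hi2)
        intro θ
        exact hpt _ (exp_norm θ)
    _ = ‖g 0‖ * (∫ θ in (0:ℝ)..(2 * Real.pi), ‖deriv f (r * Complex.exp (Complex.I * θ))‖) +
        ∫ ζ, (∫ θ in (0:ℝ)..(2 * Real.pi), BB f r ζ (Complex.exp (Complex.I * θ))) ∂ν := by
        rw [intervalIntegral.integral_add hi1 hi2, intervalIntegral.integral_const_mul, hswap]
    _ ≤ _ := by
        have a1 : ∫ θ in (0:ℝ)..(2 * Real.pi), ‖deriv f (r * Complex.exp (Complex.I * θ))‖ ≤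
            2 * Real.pi + C := by
          calc _ ≤ ∫ θ in (0:ℝ)..(2 * Real.pi), (1 + ‖deriv f (r * Complex.exp (Complex.I * θ))‖ ^ p) := by
                apply intervalIntegral.integral_mono (by positivity)
                  (hdc.norm.intervalIntegrable _ _)
                  (Continuous.intervalIntegrable (by fun_prop) _ _)
                intro θ
                have := split_le (norm_nonneg (deriv f (r * Complex.exp (Complex.I * θ)))) one_pos hp
                simp only [Real.one_rpow, one_mul] at this
                simpa [add_comm] using this
            _ = 2 * Real.pi + ∫ θ in (0:ℝ)..(2 * Real.pi), ‖deriv f (r * Complex.exp (Complex.I * θ))‖ ^ p := by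
                rw [intervalIntegral.integral_add (by simp) (hup.intervalIntegrable _ _)]
                simp
            _ ≤ _ := by
                gcongr
                exact hC r hr0 hr1
        have a2 : ∫ ζ, (∫ θ in (0:ℝ)..(2 * Real.pi), BB f r ζ (Complex.exp (Complex.I * θ))) ∂ν ≤ ∫ ζ, C' ∂ν := by
          apply integral_mono _ (integrable_const _) (fun ζ => hC' ζ r hr hr1)
          have := hBint.integral_prod_right
          simpa only [intervalIntegral.integral_of_le (by positivity : (0:ℝ) ≤ 2 * Real.pi),
            uIoc_of_le (by positivity : (0:ℝ) ≤ 2 * Real.pi)] using! this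
        gcongr

lemma KK_diff (ζ : TT) {z : ℂ} {r : ℝ} (hr : 0 ≤ r) (hr1 : r ≤ 1) (hz : ‖z‖ < 1) :
    ‖KK ζ (r * z) - KK ζ z‖ ≤ (1 - r) / (1 - ‖z‖) ^ 2 := by
  have hrz : ‖(r:ℂ) * z‖ ≤ ‖z‖ := by
    rw [norm_mul]; simp only [Complex.norm_real, Real.norm_eq_abs, abs_of_nonneg hr]
    exact mul_le_of_le_one_left (norm_nonneg _) hr1
  have h1 := one_sub_norm ζ z
  have h2 := one_sub_norm ζ (r * z)
  have n1 := one_sub_ne ζ hz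
  have n2 := one_sub_ne ζ (hrz.trans_lt hz)
  have e : KK ζ (r * z) - KK ζ z = (starRingEnd ℂ) (ζ:ℂ) * ((starRingEnd ℂ) (ζ:ℂ) * ((r - 1) * z)) /
      ((1 - (starRingEnd ℂ) (ζ:ℂ) * (r * z)) * (1 - (starRingEnd ℂ) (ζ:ℂ) * z)) := by
    unfold KK
    rw [div_sub_div _ _ n2 n1]
    congr 1; ring
  have hn : ‖((r:ℂ) - 1)‖ = 1 - r := by
    rw [← Complex.ofReal_one, ← Complex.ofReal_sub, Complex.norm_real, Real.norm_eq_abs,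
      abs_of_nonpos (by linarith)]; ring
  rw [e, norm_div, norm_mul, norm_mul, norm_mul, norm_mul, hn]
  simp only [RCLike.norm_conj, TT_norm, one_mul]
  have hp : 0 < 1 - ‖z‖ := by linarith
  have h3 : (1 - ‖z‖) ^ 2 ≤ ‖1 - (starRingEnd ℂ) (ζ:ℂ) * (r * z)‖ * ‖1 - (starRingEnd ℂ) (ζ:ℂ) * z‖ := by
    rw [sq]
    exact mul_le_mul (by linarith) h1 hp.le (norm_nonneg _)
  apply div_le_div₀ (by linarith) _ (by positivity) h3
  exact mul_le_of_le_one_right (by linarith) hz.le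

lemma KKint_diff (ν : Measure TT) [IsFiniteMeasure ν] (w : TT → ℂ) (hw : Measurable w)
    {B : ℝ} (hw1 : ∀ ζ, ‖w ζ‖ ≤ B) :
    DifferentiableOn ℂ (fun z => ∫ ζ, KK ζ z * w ζ ∂ν) (ball 0 1) := by
  have h1 : DifferentiableOn ℂ (fun z => ∫ ζ, LL ζ z * w ζ ∂ν) (ball 0 1) := fun z hz =>
    (LLint_deriv ν w hw hw1 (by simpa using hz)).differentiableAt.differentiableWithinAt
  refine (h1.deriv isOpen_ball).congr fun z hz => ?_
  exact (LLint_deriv ν w hw hw1 (by simpa using hz)).deriv.symm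

lemma main_rep {f g : ℂ → ℂ} (hf : DifferentiableOn ℂ f (ball 0 1))
    (hgd : DifferentiableOn ℂ g (ball 0 1)) {p C : ℝ} (hp : 1 < p)
    (hC : ∀ r : ℝ, 0 ≤ r → r < 1 →
      ∫ θ in (0:ℝ)..(2 * Real.pi), ‖deriv f ((r : ℂ) * Complex.exp (Complex.I * θ))‖ ^ p ≤ C)
    (ν : Measure TT) [IsFiniteMeasure ν] (w : TT → ℂ) (hw : Measurable w) (hw1 : ∀ ζ, ‖w ζ‖ = 1)
    (hg : ∀ z : ℂ, ‖z‖ < 1 → g z = g 0 + ∫ ζ, LL ζ z * w ζ ∂ν) :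
    ∃ N : FiniteMeasure (TT × TT), ∀ z : ℂ, ‖z‖ < 1 →
      deriv f z * g z + f z * (∫ ζ, KK ζ z * w ζ ∂ν) =
        ∫ x, KK x.1 z * (x.2 : ℂ) ∂(N : Measure (TT × TT)) := by
  have hpi := Real.pi_pos
  obtain ⟨C1, hC1⟩ := G_bd hf hp hC ν w hw hw1 hg
  have hd : DifferentiableOn ℂ (deriv f) (ball 0 1) := hf.deriv isOpen_ball
  have hfb := fun ζ r hr hr1 => f_bd hf hp hC ζ (r := r) hr hr1
  set Bf := ‖f 0‖ + (|C| * Real.pi ^ ((p-1)/2) + Real.pi ^ (1/2:ℝ)) with hBf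
  have hBf0 : 0 ≤ Bf := by positivity
  have hSd := KKint_diff ν w hw (fun ζ => (hw1 ζ).le)
  set S : ℂ → ℂ := fun z => ∫ ζ, KK ζ z * w ζ ∂ν with hS
  -- radii
  set r : ℕ → ℝ := fun n => 1 - 1 / ((n:ℝ) + 2) with hr
  have hr4 : ∀ n, 1/4 ≤ r n := fun n => by
    have : 1 / ((n:ℝ) + 2) ≤ 1 / 2 := by
      apply one_div_le_one_div_of_le (by norm_num); linarith [Nat.cast_nonneg (α := ℝ) n]
    simp only [hr]; linarith
  have hr1 : ∀ n, r n < 1 := fun n => by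
    have : 0 < 1 / ((n:ℝ) + 2) := by positivity
    simp only [hr]; linarith
  have hr0 : ∀ n, 0 < r n := fun n => by linarith [hr4 n]
  have hrt : Tendsto r atTop (𝓝 1) := by
    have h1 : Tendsto (fun n : ℕ => 1 / ((n:ℝ) + 2)) atTop (𝓝 0) := by
      have := (tendsto_natCast_atTop_atTop (R := ℝ)).atTop_add (tendsto_const_nhds (x := (2:ℝ)))
      exact this.inv_tendsto_atTop.congr fun n => by simp
    have h2 := h1.const_sub 1
    rw [sub_zero] at h2
    exact h2
  have hrz : ∀ n, ∀ z : ℂ, ‖z‖ ≤ 1 → (r n : ℂ) * z ∈ ball (0:ℂ) 1 := fun n z hz => by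
    have := hr1 n
    simp only [mem_ball, dist_zero_right, norm_mul, Complex.norm_real, Real.norm_eq_abs,
      abs_of_pos (hr0 n)]
    exact (mul_le_of_le_one_right (hr0 n).le hz).trans_lt this
  -- the second measure
  have hDm : ∀ n, Measurable (fun ζ : TT => f (r n * ζ) * w ζ) := fun n =>
    (comp_cont hf (fun ζ : TT => (r n : ℂ) * ζ) (by fun_prop)
      (fun ζ => by simpa using hrz n ζ (TT_norm ζ).le)).measurable.mul hw
  have hDb : ∀ n (ζ : TT), ‖f (r n * ζ) * w ζ‖ ≤ Bf := fun n ζ => by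
    rw [norm_mul, hw1, mul_one]; exact hfb ζ (r n) (hr0 n) (hr1 n)
  set S2 : ℕ → ℂ → ℂ := fun n z => ∫ ζ, KK ζ z * (f (r n * ζ) * w ζ) ∂ν with hS2
  have hS2d : ∀ n, DifferentiableOn ℂ (S2 n) (ball 0 1) := fun n =>
    KKint_diff ν _ (hDm n) (hDb n)
  have hM2 : ∀ n, ∃ M : FiniteMeasure (TT × TT), M.mass ≤ Bf.toNNReal * (ν univ).toNNReal ∧
      ∀ φ : TT → ℂ, Continuous φ → ∫ x, φ x.1 * (x.2 : ℂ) ∂(M : Measure (TT × TT)) =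
        ∫ ζ, φ ζ * (f (r n * ζ) * w ζ) ∂ν := by
    intro n
    refine density_measure ν id measurable_id _ (hDm n) _ ?_
    calc ∫⁻ ζ, ‖f (r n * ζ) * w ζ‖ₑ ∂ν ≤ ∫⁻ ζ : TT, (Bf.toNNReal : ENNReal) ∂ν := by
          refine lintegral_mono fun ζ => ?_
          rw [← ofReal_norm]
          exact ENNReal.ofReal_le_ofReal (hDb n ζ)
      _ = _ := by
          rw [lintegral_const, ENNReal.coe_mul, ENNReal.coe_toNNReal (measure_ne_top _ _)]
  -- the first measure
  set G : ℕ → ℂ → ℂ := fun n z => deriv f (r n * z) * g (r n * z) +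
    (f (r n * z) * S (r n * z) - S2 n (r n * z)) with hG
  have hGd : ∀ n, DifferentiableOn ℂ (G n) (closedBall 0 1) := by
    intro n
    have hm : MapsTo (fun z : ℂ => (r n : ℂ) * z) (closedBall 0 1) (ball 0 1) := fun z hz =>
      hrz n z (by simpa using hz)
    have hl : DifferentiableOn ℂ (fun z : ℂ => (r n : ℂ) * z) (closedBall 0 1) := by fun_prop
    exact ((hd.comp hl hm).mul (hgd.comp hl hm)).add
      (((hf.comp hl hm).mul (hSd.comp hl hm)).sub ((hS2d n).comp hl hm))
  have hGb : ∀ n, ∫ θ in (0:ℝ)..(2 * Real.pi), ‖G n (Complex.exp (Complex.I * θ))‖ ≤ C1 := fun n =>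
    hC1 (r n) (hr4 n) (hr1 n) (G n) (hGd n).continuousOn fun z _ => rfl
  let e : ℝ → TT := fun θ => ⟨Complex.exp (Complex.I * θ), by simp [exp_norm]⟩
  have hem : Measurable e := by
    apply Continuous.measurable
    apply Continuous.subtype_mk
    fun_prop
  have hec : Continuous (fun θ : ℝ => Complex.exp (Complex.I * θ)) := by fun_prop
  have hGc : ∀ n, Continuous (fun θ : ℝ => G n (Complex.exp (Complex.I * θ))) := fun n =>
    (hGd n).continuousOn.comp_continuous hec fun θ => by simp [exp_norm]
  have hM1 : ∀ n, ∃ M : FiniteMeasure (TT × TT), M.mass ≤ C1.toNNReal ∧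
      ∀ φ : TT → ℂ, Continuous φ → ∫ x, φ x.1 * (x.2 : ℂ) ∂(M : Measure (TT × TT)) =
        ∫ θ in Ioc (0:ℝ) (2 * Real.pi), φ (e θ) * ((1 / (2 * Real.pi)) *
          (Complex.exp (Complex.I * θ) * G n (Complex.exp (Complex.I * θ)))) := by
    intro n
    refine density_measure _ e hem _ (Continuous.measurable (continuous_const.mul (hec.mul (hGc n)))) _ ?_
    calc _ ≤ ∫⁻ θ in Ioc (0:ℝ) (2 * Real.pi), ENNReal.ofReal ‖G n (Complex.exp (Complex.I * θ))‖ := by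
          refine lintegral_mono fun θ => ?_
          rw [← ofReal_norm]
          apply ENNReal.ofReal_le_ofReal
          change ‖(1 / (2 * Real.pi) : ℂ) * (Complex.exp (Complex.I * θ) *
            G n (Complex.exp (Complex.I * θ)))‖ ≤ _
          rw [norm_mul, norm_mul, exp_norm, one_mul]
          refine mul_le_of_le_one_left (norm_nonneg _) ?_
          simp only [norm_div, norm_one, norm_mul, Complex.norm_ofNat, Complex.norm_real,
            Real.norm_eq_abs, abs_of_pos hpi]
          rw [div_le_one (by positivity)]
          linarith [Real.pi_gt_three]
      _ = ENNReal.ofReal (∫ θ in Ioc (0:ℝ) (2 * Real.pi), ‖G n (Complex.exp (Complex.I * θ))‖) := by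
          rw [ofReal_integral_eq_lintegral_ofReal]
          · exact (hGc n).norm.integrableOn_Ioc
          · exact Eventually.of_forall fun _ => norm_nonneg _
      _ ≤ _ := by
          have := hGb n
          rw [intervalIntegral.integral_of_le (by positivity)] at this
          exact ENNReal.ofReal_le_ofReal this
  choose M1 hM1m hM1i using hM1
  choose M2 hM2m hM2i using hM2
  set U : Ultrafilter ℕ := hyperfilter ℕ with hU
  have hUle : (U : Filter ℕ) ≤ atTop := Nat.hyperfilter_le_atTop
  obtain ⟨N1, hN1⟩ := weak_limit U _ M1 hM1m
  obtain ⟨N2, hN2⟩ := weak_limit U _ M2 hM2m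
  refine ⟨N1 + N2, fun z hz => ?_⟩
  have hck : Continuous fun ζ => KK ζ z := KK_cont _ _ continuous_id continuous_const fun _ => hz
  have t1 := hN1 _ hck
  have t2 := hN2 _ hck
  have hz1 : z ∈ ball (0:ℂ) 1 := by simpa using hz
  -- identify
  have i1 : ∀ n, ∫ x, KK x.1 z * (x.2 : ℂ) ∂(M1 n : Measure (TT × TT)) = G n z := fun n => by
    rw [hM1i n _ hck]
    exact cauchy_rep (hGd n) hz e fun θ => rfl
  have i2 : ∀ n, ∫ x, KK x.1 z * (x.2 : ℂ) ∂(M2 n : Measure (TT × TT)) = S2 n z := fun n => by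
    rw [hM2i n _ hck]
  simp_rw [i1] at t1
  simp_rw [i2] at t2
  have t3 : Tendsto (fun n => S2 n (r n * z) - S2 n z) U (𝓝 0) := by
    refine Tendsto.mono_left ?_ hUle
    have hb : ∀ n, ‖S2 n (r n * z) - S2 n z‖ ≤ (1 - r n) * (1 / (1 - ‖z‖) ^ 2 * Bf * (ν univ).toReal) := by
      intro n
      have c1 : Continuous fun ζ : TT => KK ζ (r n * z) :=
        KK_cont _ _ continuous_id continuous_const fun _ => by simpa using hrz n z hz.le
      simp only [hS2]
      rw [← integral_sub (int_bdd ν _ _ c1 (hDm n) ⟨Bf, hDb n⟩) (int_bdd ν _ _ hck (hDm n) ⟨Bf, hDb n⟩)]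
      refine (norm_integral_le_of_norm_le_const (C := (1 - r n) / (1 - ‖z‖) ^ 2 * Bf)
        (Eventually.of_forall fun ζ => ?_)).trans (le_of_eq ?_)
      · rw [← sub_mul, norm_mul]
        exact mul_le_mul (KK_diff ζ (hr0 n).le (hr1 n).le hz) (hDb n ζ) (norm_nonneg _)
          (div_nonneg (by linarith [hr1 n]) (by positivity))
      · rw [measureReal_def]; ring
    refine squeeze_zero_norm hb ?_
    have := (hrt.const_sub 1).mul_const (1 / (1 - ‖z‖) ^ 2 * Bf * (ν univ).toReal)
    simpa using this
  have hrzt : Tendsto (fun n => (r n : ℂ) * z) U (𝓝 z) := by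
    refine Tendsto.mono_left ?_ hUle
    have h1 : Tendsto (fun n => (r n : ℂ)) atTop (𝓝 ((1:ℝ):ℂ)) :=
      (Complex.continuous_ofReal.tendsto 1).comp hrt
    simpa using h1.mul_const z
  have hcomp : ∀ F : ℂ → ℂ, DifferentiableOn ℂ F (ball 0 1) →
      Tendsto (fun n => F (r n * z)) U (𝓝 (F z)) := fun F hF =>
    ((hF.differentiableAt (isOpen_ball.mem_nhds hz1)).continuousAt.tendsto).comp hrzt
  have t4 : Tendsto (fun n => deriv f (r n * z) * g (r n * z) + f (r n * z) * S (r n * z)) U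
      (𝓝 (deriv f z * g z + f z * S z)) :=
    ((hcomp _ hd).mul (hcomp _ hgd)).add ((hcomp _ hf).mul (hcomp _ hSd))
  have t5 := (t1.add t3).add t2
  have heq : (fun n => G n z + (S2 n (r n * z) - S2 n z) + S2 n z) =
      fun n => deriv f (r n * z) * g (r n * z) + f (r n * z) * S (r n * z) := by
    ext n; simp only [hG]; ring
  rw [heq] at t5
  have := tendsto_nhds_unique t4 t5
  rw [this, FiniteMeasure.toMeasure_add, integral_add_measure, add_zero]
  all_goals
    obtain ⟨B, hB⟩ := (isCompact_univ (X := TT × TT)).exists_bound_of_continuousOn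
      (f := fun x : TT × TT => KK x.1 z * (x.2 : ℂ)) (Continuous.continuousOn
        ((hck.comp continuous_fst).mul (by fun_prop)))
    exact Integrable.of_bound (Continuous.aestronglyMeasurable
      ((hck.comp continuous_fst).mul (by fun_prop))) B
      (Eventually.of_forall fun x => hB x (mem_univ _))


/-- **Theorem B.** If `f` is analytic on the unit disk and `f' ∈ H^p` for some `p > 1`,
then `f` is a multiplier of `F₀`. -/
theorem stmt_9 (f : ℂ → ℂ) (hf : DifferentiableOn ℂ f (ball 0 1))
    (p : ℝ) (hp : 1 < p)
    (hHp : ∃ C : ℝ, ∀ r : ℝ, 0 ≤ r → r < 1 →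
      ∫ θ in (0:ℝ)..(2 * Real.pi),
        ‖deriv f ((r : ℂ) * Complex.exp (Complex.I * θ))‖ ^ p ≤ C) :
    MemM0 f := by
  obtain ⟨C, hC⟩ := hHp
  refine ⟨hf, fun g hg => ?_⟩
  obtain ⟨hgd, μ, hμ⟩ := hg
  have hfin := μ.finite
  have hrep : ∀ z : ℂ, ‖z‖ < 1 → g z = g 0 + ∫ ζ, LL ζ z * μ.w ζ ∂μ.ν := fun z hz =>
    hμ z (by simpa using hz)
  obtain ⟨N, hN⟩ := main_rep hf hgd hp hC μ.ν μ.w μ.w_meas μ.w_norm hrep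
  obtain ⟨σ, hσ⟩ := realize N
  have hσf := σ.finite
  have hfg : DifferentiableOn ℂ (fun z => f z * g z) (ball 0 1) := hf.mul hgd
  refine ⟨hfg, σ, fun z hz => ?_⟩
  have hdσ : ∀ z : ℂ, ‖z‖ < 1 → HasDerivAt (fun z => ∫ ζ, LL ζ z * σ.w ζ ∂σ.ν)
      (∫ ζ, KK ζ z * σ.w ζ ∂σ.ν) z := fun z hz =>
    LLint_deriv σ.ν σ.w σ.w_meas (fun ζ => (σ.w_norm ζ).le) hz
  have hdg : ∀ z : ℂ, ‖z‖ < 1 → HasDerivAt g (∫ ζ, KK ζ z * μ.w ζ ∂μ.ν) z := fun z hz => by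
    have h1 := (LLint_deriv μ.ν μ.w μ.w_meas (fun ζ => (μ.w_norm ζ).le) hz).const_add (g 0)
    refine h1.congr_of_eventuallyEq ?_
    filter_upwards [isOpen_ball.mem_nhds (show z ∈ ball (0:ℂ) 1 by simpa using hz)] with x hx
    exact hrep x (by simpa using hx)
  have hdh : ∀ z : ℂ, ‖z‖ < 1 →
      HasDerivAt (fun z => f z * g z - ∫ ζ, LL ζ z * σ.w ζ ∂σ.ν) 0 z := fun z hz => by
    have h1 : HasDerivAt f (deriv f z) z :=
      (hf.differentiableAt (isOpen_ball.mem_nhds (by simpa using hz))).hasDerivAt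
    have h2 := (h1.mul (hdg z hz)).sub (hdσ z hz)
    have h3 : ∫ ζ, KK ζ z * σ.w ζ ∂σ.ν =
        deriv f z * g z + f z * ∫ ζ, KK ζ z * μ.w ζ ∂μ.ν := by
      rw [hN z hz]
      exact hσ (fun ζ => KK ζ z) (KK_cont _ _ continuous_id continuous_const fun _ => hz)
    rw [h3, sub_self] at h2
    exact h2
  have hconst := isOpen_ball.is_const_of_deriv_eq_zero (convex_ball (0:ℂ) 1).isPreconnected
    (f := fun z => f z * g z - ∫ ζ, LL ζ z * σ.w ζ ∂σ.ν)
    (fun x hx => (hdh x (by simpa using hx)).differentiableAt.differentiableWithinAt)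
    (fun x hx => (hdh x (by simpa using hx)).deriv) hz (mem_ball_self one_pos)
  have h0 : ∫ ζ, LL ζ 0 * σ.w ζ ∂σ.ν = 0 := by simp [LL]
  simp only [h0, sub_zero] at hconst
  change f z * g z = f 0 * g 0 + ∫ ζ, LL ζ z * σ.w ζ ∂σ.ν
  linear_combination hconst
end
end

section
/- If f ∈ m_0 (a multiplier of F_0), then f is a multiplier of the Bloch space B. -/
open MeasureTheory Metric Set Complex

noncomputable section

/-- Membership in the Bloch space: analytic on the disk with
`sup |g'(z)|(1-|z|²) < ∞`. -/
def MemBloch (g : ℂ → ℂ) : Prop :=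
  DifferentiableOn ℂ g (ball 0 1) ∧
    ∃ C : ℝ, ∀ z ∈ ball (0:ℂ) 1, ‖deriv g z‖ * (1 - ‖z‖ ^ 2) ≤ C


local notation "Circ" => Metric.sphere (0:ℂ) 1

lemma aux_unif {Z : Type} (k : Z → Circ → ℂ) (hk : ∀ i, Continuous (k i))
    (h : ∀ (ν : Measure Circ) [IsFiniteMeasure ν] (a : Circ → ℂ), Measurable a → Integrable a ν →
      ∃ C : ℝ, ∀ i, ‖∫ ζ, k i ζ * a ζ ∂ν‖ ≤ C) :
    ∃ C : ℝ, ∀ i ζ, ‖k i ζ‖ ≤ C := by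
  have : Nonempty Circ := ⟨⟨1, by simp⟩⟩
  let d := TopologicalSpace.denseSeq Circ
  let ν : Measure Circ := Measure.sum (fun n : ℕ => ((1/2 : ENNReal)^(n+1)) • Measure.dirac (d n))
  have hνfin : IsFiniteMeasure ν := by
    refine ⟨?_⟩
    simp only [ν, Measure.sum_apply _ MeasurableSet.univ, Measure.smul_apply, measure_univ,
      smul_eq_mul, mul_one]
    have := ENNReal.tsum_geometric_add_one (1/2 : ENNReal)
    rw [this]
    exact ENNReal.mul_lt_top (by simp) (by simp)
  have hatom : ∀ n, ν {d n} ≠ 0 := by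
    intro n h0
    have h1 : (((1/2 : ENNReal)^(n+1)) • Measure.dirac (d n)) {d n} ≤ ν {d n} :=
      Measure.le_sum (fun n : ℕ => ((1/2 : ENNReal)^(n+1)) • Measure.dirac (d n)) n {d n}
    rw [h0] at h1
    simp at h1
  have hbd : ∀ i, ∃ M : ℝ, ∀ ζ, ‖k i ζ‖ ≤ M := by
    intro i
    obtain ⟨M, hM⟩ := isCompact_univ.exists_bound_of_continuousOn (hk i).continuousOn
    exact ⟨M, fun ζ => hM ζ (mem_univ _)⟩
  choose M hM using hbd
  have hint : ∀ i (a : Lp ℂ 1 ν), Integrable (fun ζ => k i ζ * a ζ) ν := fun i a =>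
    (L1.integrable_coeFn a).bdd_mul (hk i).aestronglyMeasurable (Filter.Eventually.of_forall (hM i))
  let T : Z → (Lp ℂ 1 ν →L[ℂ] ℂ) := fun i =>
    LinearMap.mkContinuous
      { toFun := fun a => ∫ ζ, k i ζ * a ζ ∂ν
        map_add' := by
          intro a b
          rw [← integral_add (hint i a) (hint i b)]
          refine integral_congr_ae ?_
          filter_upwards [Lp.coeFn_add a b] with x hx
          rw [hx]; simp [mul_add]
        map_smul' := by
          intro c a
          simp only [RingHom.id_apply, smul_eq_mul]
          rw [← integral_const_mul]
          refine integral_congr_ae ?_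
          filter_upwards [Lp.coeFn_smul c a] with x hx
          rw [hx]; simp; ring } (M i) (by
        intro a
        simp only [LinearMap.coe_mk, AddHom.coe_mk]
        rw [L1.norm_eq_integral_norm, ← integral_const_mul]
        refine norm_integral_le_of_norm_le ((L1.integrable_coeFn a).norm.const_mul _) ?_
        refine Filter.Eventually.of_forall fun x => ?_
        rw [norm_mul]
        exact mul_le_mul_of_nonneg_right (hM i x) (norm_nonneg _))
  have hT : ∀ i a, T i a = ∫ ζ, k i ζ * a ζ ∂ν := fun i a => rfl
  obtain ⟨C, hC⟩ := banach_steinhaus (g := T) (by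
    intro a
    obtain ⟨C, hC⟩ := h ν a (Lp.stronglyMeasurable a).measurable (L1.integrable_coeFn a)
    exact ⟨C, fun i => by rw [hT]; exact hC i⟩)
  refine ⟨C, fun i => ?_⟩
  have hcl : IsClosed {ζ | ‖k i ζ‖ ≤ C} := isClosed_le (hk i).norm continuous_const
  have hd : ∀ n, ‖k i (d n)‖ ≤ C := by
    intro n
    have h1 := (T i).le_of_opNorm_le (hC i)
      (indicatorConstLp 1 (measurableSet_singleton (d n)) (measure_ne_top ν _) (1:ℂ))
    rw [hT, norm_indicatorConstLp (by simp) (by simp)] at h1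
    have h2 : ∫ ζ, k i ζ * (indicatorConstLp 1 (measurableSet_singleton (d n))
        (measure_ne_top ν _) (1:ℂ) : Lp ℂ 1 ν) ζ ∂ν = (ν.real {d n} : ℂ) * k i (d n) := by
      have : ∫ ζ, k i ζ * (indicatorConstLp 1 (measurableSet_singleton (d n))
        (measure_ne_top ν _) (1:ℂ) : Lp ℂ 1 ν) ζ ∂ν =
          ∫ ζ, ({d n} : Set Circ).indicator (fun _ => k i (d n)) ζ ∂ν := by
        refine integral_congr_ae ?_
        filter_upwards [indicatorConstLp_coeFn (p := 1) (hs := measurableSet_singleton (d n))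
          (hμs := measure_ne_top ν _) (c := (1:ℂ))] with x hx
        rw [hx]
        by_cases hxd : x = d n
        · simp [hxd]
        · simp [hxd]
      rw [this, integral_indicator (measurableSet_singleton _), setIntegral_const]
      simp
    have hpos : 0 < ν.real {d n} := ENNReal.toReal_pos (hatom n) (measure_ne_top _ _)
    rw [h2] at h1
    simp only [norm_mul, Complex.norm_real, Real.norm_eq_abs, abs_of_pos hpos] at h1
    simp at h1
    nlinarith
  have := (TopologicalSpace.denseRange_denseSeq Circ).closure_eq
  intro ζ
  have hsub : closure (range d) ⊆ {ζ | ‖k i ζ‖ ≤ C} :=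
    hcl.closure_subset_iff.2 (by rintro _ ⟨n, rfl⟩; exact hd n)
  exact hsub (by rw [this]; trivial)

def Lk (ζ : Circ) (z : ℂ) : ℂ := Complex.log (1 / (1 - (starRingEnd ℂ) (ζ:ℂ) * z))
def Pk (ζ : Circ) (z : ℂ) : ℂ := (starRingEnd ℂ) (ζ:ℂ) / (1 - (starRingEnd ℂ) (ζ:ℂ) * z)

lemma aux_norm (ζ : Circ) (z : ℂ) : ‖(starRingEnd ℂ) (ζ:ℂ) * z‖ = ‖z‖ := by
  simp

lemma aux_den (ζ : Circ) (z : ℂ) : 1 - ‖z‖ ≤ ‖1 - (starRingEnd ℂ) (ζ:ℂ) * z‖ := by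
  have := norm_sub_norm_le (1:ℂ) ((starRingEnd ℂ) (ζ:ℂ) * z)
  rw [aux_norm] at this
  simpa using this

lemma aux_slit (ζ : Circ) {z : ℂ} (hz : ‖z‖ < 1) :
    1 - (starRingEnd ℂ) (ζ:ℂ) * z ∈ slitPlane := by
  left
  have := Complex.re_le_norm ((starRingEnd ℂ) (ζ:ℂ) * z)
  rw [aux_norm] at this
  rw [Complex.sub_re, Complex.one_re]
  linarith

lemma aux_Lk (ζ : Circ) {z : ℂ} (hz : ‖z‖ < 1) :
    Lk ζ z = - Complex.log (1 - (starRingEnd ℂ) (ζ:ℂ) * z) := by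
  rw [Lk, one_div, Complex.log_inv]
  exact (Complex.mem_slitPlane_iff_arg.1 (aux_slit ζ hz)).1

lemma aux_contL {z : ℂ} (hz : ‖z‖ < 1) : Continuous (fun ζ => Lk ζ z) := by
  have : (fun ζ => Lk ζ z) = fun ζ : Circ => - Complex.log (1 - (starRingEnd ℂ) (ζ:ℂ) * z) := by
    funext ζ; exact aux_Lk ζ hz
  rw [this]
  refine Continuous.neg (Continuous.clog ?_ (fun ζ => aux_slit ζ hz))
  exact continuous_const.sub ((Complex.continuous_conj.comp continuous_subtype_val).mul
    continuous_const)

lemma aux_contP {z : ℂ} (hz : ‖z‖ < 1) : Continuous (fun ζ => Pk ζ z) := by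
  refine Continuous.div (Complex.continuous_conj.comp continuous_subtype_val) ?_
    (fun ζ => slitPlane_ne_zero (aux_slit ζ hz))
  exact continuous_const.sub ((Complex.continuous_conj.comp continuous_subtype_val).mul
    continuous_const)

lemma aux_normP (ζ : Circ) {z : ℂ} (hz : ‖z‖ < 1) : ‖Pk ζ z‖ ≤ 1 / (1 - ‖z‖) := by
  have h1 : ‖(ζ:ℂ)‖ = 1 := by simp
  rw [Pk, norm_div, RCLike.norm_conj, h1]
  exact one_div_le_one_div_of_le (by linarith) (aux_den ζ z)

lemma aux_derivL (ζ : Circ) {z : ℂ} (hz : ‖z‖ < 1) : HasDerivAt (fun z => Lk ζ z) (Pk ζ z) z := by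
  have h1 : HasDerivAt (fun z => - Complex.log (1 - (starRingEnd ℂ) (ζ:ℂ) * z)) (Pk ζ z) z := by
    have h2 : HasDerivAt (fun z : ℂ => 1 - (starRingEnd ℂ) (ζ:ℂ) * z) (-(starRingEnd ℂ) (ζ:ℂ)) z := by
      simpa using ((hasDerivAt_id z).const_mul ((starRingEnd ℂ) (ζ:ℂ))).const_sub 1
    refine (h2.clog (aux_slit ζ hz)).neg.congr_deriv ?_
    rw [Pk]; ring
  refine h1.congr_of_eventuallyEq ?_
  have : ball (0:ℂ) 1 ∈ nhds z := isOpen_ball.mem_nhds (by simpa using hz)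
  filter_upwards [this] with w hw
  exact aux_Lk ζ (by simpa using hw)

lemma aux_intL (ν : Measure Circ) (a : Circ → ℂ) (ha : Integrable a ν) {z : ℂ} (hz : ‖z‖ < 1) :
    Integrable (fun ζ => Lk ζ z * a ζ) ν := by
  obtain ⟨M, hM⟩ := isCompact_univ.exists_bound_of_continuousOn (aux_contL hz).continuousOn
  exact ha.bdd_mul (aux_contL hz).aestronglyMeasurable
    (Filter.Eventually.of_forall fun x => hM x (mem_univ _))

lemma aux_deriv (ν : Measure Circ) (a : Circ → ℂ) (ha : Integrable a ν) {z : ℂ} (hz : ‖z‖ < 1) :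
    Integrable (fun ζ => Pk ζ z * a ζ) ν ∧
    HasDerivAt (fun z => ∫ ζ, Lk ζ z * a ζ ∂ν) (∫ ζ, Pk ζ z * a ζ ∂ν) z := by
  obtain ⟨ρ, h1, h2⟩ := exists_between hz
  have hs : ball (0:ℂ) ρ ∈ nhds z := isOpen_ball.mem_nhds (by simpa using h1)
  refine hasDerivAt_integral_of_dominated_loc_of_deriv_le
    (F := fun z ζ => Lk ζ z * a ζ) (F' := fun z ζ => Pk ζ z * a ζ)
    (bound := fun ζ => 1 / (1 - ρ) * ‖a ζ‖) hs ?_ (aux_intL ν a ha hz) ?_ ?_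
    (ha.norm.const_mul _) ?_
  · filter_upwards [hs] with w hw
    exact (aux_intL ν a ha (by simp at hw; linarith)).aestronglyMeasurable
  · exact (aux_contP hz).aestronglyMeasurable.mul ha.aestronglyMeasurable
  · refine Filter.Eventually.of_forall fun ζ w hw => ?_
    simp at hw
    rw [norm_mul]
    refine mul_le_mul_of_nonneg_right ((aux_normP ζ (by linarith)).trans ?_) (norm_nonneg _)
    exact one_div_le_one_div_of_le (by linarith) (by linarith)
  · refine Filter.Eventually.of_forall fun ζ w hw => ?_
    simp at hw
    exact (aux_derivL ζ (by linarith)).mul_const _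

lemma aux_normint (ν : Measure Circ) (a : Circ → ℂ) (ha : Integrable a ν) {z : ℂ} (hz : ‖z‖ < 1) :
    (1 - ‖z‖) * ‖∫ ζ, Pk ζ z * a ζ ∂ν‖ ≤ ∫ ζ, ‖a ζ‖ ∂ν := by
  have : ‖∫ ζ, Pk ζ z * a ζ ∂ν‖ ≤ ∫ ζ, 1 / (1 - ‖z‖) * ‖a ζ‖ ∂ν := by
    refine norm_integral_le_of_norm_le (ha.norm.const_mul _)
      (Filter.Eventually.of_forall fun ζ => ?_)
    rw [norm_mul]
    exact mul_le_mul_of_nonneg_right (aux_normP ζ hz) (norm_nonneg _)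
  rw [integral_const_mul, one_div, ← div_eq_inv_mul, le_div_iff₀ (by linarith)] at this
  linarith

lemma aux_F0bloch {g : ℂ → ℂ} (hg : MemF0 g) :
    ∃ C : ℝ, ∀ z : ℂ, ‖z‖ < 1 → (1 - ‖z‖) * ‖deriv g z‖ ≤ C := by
  obtain ⟨_, μ, hμ⟩ := hg
  have := μ.finite
  have hw : Integrable μ.w μ.ν :=
    Integrable.of_bound μ.w_meas.aestronglyMeasurable 1
      (Filter.Eventually.of_forall fun ζ => (μ.w_norm ζ).le)
  refine ⟨∫ ζ, ‖μ.w ζ‖ ∂μ.ν, fun z hz => ?_⟩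
  have h1 : HasDerivAt g (∫ ζ, Pk ζ z * μ.w ζ ∂μ.ν) z := by
    refine ((aux_deriv μ.ν μ.w hw hz).2.const_add (g 0)).congr_of_eventuallyEq ?_
    have : ball (0:ℂ) 1 ∈ nhds z := isOpen_ball.mem_nhds (by simpa using hz)
    filter_upwards [this] with x hx
    exact hμ x hx
  rw [h1.deriv]
  exact aux_normint μ.ν μ.w hw hz

lemma aux_mem (ν : Measure Circ) (a : Circ → ℂ) (ham : Measurable a) (ha : Integrable a ν) :
    MemF0 (fun z => ∫ ζ, Lk ζ z * a ζ ∂ν) := by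
  refine ⟨fun z hz => ((aux_deriv ν a ha (by simpa using hz)).2).differentiableAt.differentiableWithinAt, ?_⟩
  refine ⟨⟨ν.withDensity (fun ζ => (‖a ζ‖₊ : ENNReal)), ?_,
    fun ζ => if a ζ = 0 then 1 else a ζ / ‖a ζ‖, ?_, ?_⟩, ?_⟩
  · refine ⟨?_⟩
    rw [withDensity_apply _ MeasurableSet.univ, Measure.restrict_univ]
    exact ha.2
  · exact Measurable.ite (measurableSet_eq_fun ham measurable_const) measurable_const
      (ham.div (Complex.measurable_ofReal.comp ham.norm))
  · intro ζ
    by_cases h : a ζ = 0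
    · simp [h]
    · simp [h]
  · intro z hz
    have h0 : ∫ ζ, Lk ζ 0 * a ζ ∂ν = 0 := by simp [Lk]
    simp only [CircleMeasure.integral]
    rw [h0, zero_add, integral_withDensity_eq_integral_smul ham.nnnorm]
    refine integral_congr_ae (Filter.Eventually.of_forall fun ζ => ?_)
    simp only [NNReal.smul_def, coe_nnnorm, Complex.real_smul]
    change Lk ζ z * a ζ = ‖a ζ‖ * (Lk ζ z * _)
    by_cases h : a ζ = 0
    · simp [h]
    · have : (‖a ζ‖ : ℂ) ≠ 0 := by simpa using h
      simp only [h, if_false]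
      field_simp

lemma aux_one : MemF0 (fun _ => 1) := by
  refine ⟨differentiableOn_const _, ⟨0, inferInstance, fun _ => 1, measurable_const, by simp⟩, ?_⟩
  intro z _
  simp [CircleMeasure.integral]

lemma aux_key {f : ℂ → ℂ} (hf : MemM0 f) :
    ∃ C : ℝ, ∀ (z : ℂ) (ζ : Circ), ‖z‖ < 1 →
      (1 - ‖z‖) * ‖deriv f z * Lk ζ z + f z * Pk ζ z‖ ≤ C := by
  obtain ⟨C, hC⟩ := aux_unif (Z := ball (0:ℂ) 1)
    (fun z ζ => ((1 - ‖(z:ℂ)‖ : ℝ) : ℂ) * (deriv f z * Lk ζ z + f z * Pk ζ z)) (by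
      intro z
      have hz : ‖(z:ℂ)‖ < 1 := mem_ball_zero_iff.1 z.2
      exact continuous_const.mul ((continuous_const.mul (aux_contL hz)).add
        (continuous_const.mul (aux_contP hz)))) (by
      intro ν _ a ham ha
      obtain ⟨C, hC⟩ := aux_F0bloch (hf.2 _ (aux_mem ν a ham ha))
      refine ⟨C, fun z => ?_⟩
      have hz : ‖(z:ℂ)‖ < 1 := mem_ball_zero_iff.1 z.2
      have hfd : HasDerivAt f (deriv f z) z :=
        (hf.1.differentiableAt (isOpen_ball.mem_nhds z.2)).hasDerivAt
      have h1 := hfd.mul (aux_deriv ν a ha hz).2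
      have h2 := hC z hz
      have h3 : deriv (fun z => f z * ∫ ζ, Lk ζ z * a ζ ∂ν) z = _ := h1.deriv
      rw [h3] at h2
      have h4 : ∫ ζ, ((1 - ‖(z:ℂ)‖ : ℝ) : ℂ) * (deriv f z * Lk ζ z + f z * Pk ζ z) * a ζ ∂ν =
          ((1 - ‖(z:ℂ)‖ : ℝ) : ℂ) * (deriv f z * (∫ ζ, Lk ζ z * a ζ ∂ν)
            + f z * ∫ ζ, Pk ζ z * a ζ ∂ν) := by
        rw [← integral_const_mul, ← integral_const_mul, ← integral_add
          ((aux_intL ν a ha hz).const_mul _) ((aux_deriv ν a ha hz).1.const_mul _),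
          ← integral_const_mul]
        congr 1; funext ζ; ring
      rw [h4, norm_mul, Complex.norm_real, Real.norm_eq_abs, abs_of_pos (by linarith)]
      exact h2)
  refine ⟨C, fun z ζ hz => ?_⟩
  have := hC ⟨z, by simpa using hz⟩ ζ
  rwa [norm_mul, Complex.norm_real, Real.norm_eq_abs, abs_of_pos (by simpa using hz)] at this

lemma aux_polar (z : ℂ) : ∃ ζ : Circ, z = ‖z‖ * (ζ:ℂ) := by
  by_cases h : z = 0
  · exact ⟨⟨1, by simp⟩, by simp [h]⟩
  · have : (‖z‖ : ℂ) ≠ 0 := by simpa using h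
    refine ⟨⟨z / ‖z‖, by simp [h]⟩, ?_⟩
    field_simp

lemma aux_conj (ζ : Circ) : (starRingEnd ℂ) (ζ:ℂ) * ζ = 1 := by
  have : ‖(ζ:ℂ)‖ = 1 := by simp
  rw [mul_comm, Complex.mul_conj, Complex.normSq_eq_norm_sq, this]; simp

lemma aux_radial {z : ℂ} {ζ : Circ} (h : z = ‖z‖ * (ζ:ℂ)) :
    1 - (starRingEnd ℂ) (ζ:ℂ) * z = ((1 - ‖z‖ : ℝ) : ℂ) := by
  have h2 := aux_conj ζ
  have : (starRingEnd ℂ) (ζ:ℂ) * z = ‖z‖ * ((starRingEnd ℂ) (ζ:ℂ) * ζ) := by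
    conv_lhs => rw [h]
    ring
  rw [this, h2]; push_cast; ring

lemma aux_Lrad {z : ℂ} {ζ : Circ} (h : z = ‖z‖ * (ζ:ℂ)) (hz : ‖z‖ < 1) :
    Lk ζ z = ((-Real.log (1 - ‖z‖) : ℝ) : ℂ) := by
  rw [aux_Lk ζ hz, aux_radial h, ← Complex.ofReal_log (by linarith)]
  push_cast; ring

lemma aux_rotate {z : ℂ} {ζ : Circ} (h : z = ‖z‖ * (ζ:ℂ)) (hz : ‖z‖ < 1) :
    ∃ ζ' : Circ, ‖Lk ζ z - Lk ζ' z‖ ≤ 1 + Real.pi ∧ 1 / 4 ≤ (1 - ‖z‖) * ‖Pk ζ z - Pk ζ' z‖ := by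
  set t : ℝ := 1 - ‖z‖ with ht
  have ht0 : 0 < t := by linarith
  have ht1 : t ≤ 1 := by have := norm_nonneg z; linarith
  have hζn : ‖(ζ:ℂ)‖ = 1 := by simp
  let e : ℂ := Complex.exp (Complex.I * t)
  have hen : ‖e‖ = 1 := by
    simp only [e]; rw [mul_comm]; exact Complex.norm_exp_ofReal_mul_I t
  have he1 : ‖e - 1‖ ≤ t := by
    have := Real.norm_exp_I_mul_ofReal_sub_one_le (x := t)
    rwa [Real.norm_eq_abs, abs_of_pos ht0] at this
  have he2 : t / 2 ≤ ‖e - 1‖ := by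
    have h1 : (e - 1).im = Real.sin t := by
      simp only [e]
      rw [mul_comm, Complex.exp_mul_I]
      simp [← Complex.ofReal_cos, ← Complex.ofReal_sin]
    have h2 := Complex.im_le_norm (e - 1)
    rw [h1] at h2
    have h3 := Real.mul_le_sin ht0.le (by have := Real.pi_gt_three; linarith)
    have h4 : 1/2 ≤ 2 / Real.pi := by
      rw [div_le_div_iff₀ (by norm_num) Real.pi_pos]
      have := Real.pi_le_four; linarith
    nlinarith
  let ζ' : Circ := ⟨ζ * e, by simp [hen, hζn]⟩
  have hdiff : ‖(starRingEnd ℂ) (ζ:ℂ) - (starRingEnd ℂ) (ζ':ℂ)‖ = ‖e - 1‖ := by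
    rw [← map_sub, RCLike.norm_conj]
    have : (ζ:ℂ) - (ζ':ℂ) = - (ζ * (e - 1)) := by simp only [ζ']; ring
    rw [this, norm_neg, norm_mul, hζn, one_mul]
  have hrad : 1 - (starRingEnd ℂ) (ζ:ℂ) * z = (t : ℂ) := aux_radial h
  have hup : ‖1 - (starRingEnd ℂ) (ζ':ℂ) * z‖ ≤ 2 * t := by
    have : 1 - (starRingEnd ℂ) (ζ':ℂ) * z = (t:ℂ)
        + ((starRingEnd ℂ) (ζ:ℂ) - (starRingEnd ℂ) (ζ':ℂ)) * z := by rw [← hrad]; ring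
    rw [this]
    refine (norm_add_le _ _).trans ?_
    rw [norm_mul, hdiff, Complex.norm_real, Real.norm_eq_abs, abs_of_pos ht0]
    nlinarith [norm_nonneg z, norm_nonneg (e-1)]
  have hlo : t ≤ ‖1 - (starRingEnd ℂ) (ζ':ℂ) * z‖ := aux_den ζ' z
  set q := 1 - (starRingEnd ℂ) (ζ':ℂ) * z with hq
  have hq0 : q ≠ 0 := slitPlane_ne_zero (aux_slit ζ' hz)
  have htc : (t:ℂ) ≠ 0 := by exact_mod_cast ht0.ne'
  refine ⟨ζ', ?_, ?_⟩
  · rw [aux_Lrad h hz, aux_Lk ζ' hz, ← hq, ← ht]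
    refine (Complex.norm_le_abs_re_add_abs_im _).trans ?_
    have hre : (((-Real.log t : ℝ) : ℂ) - -Complex.log q).re = Real.log ‖q‖ - Real.log t := by
      simp [Complex.log_re]; ring
    have him : (((-Real.log t : ℝ) : ℂ) - -Complex.log q).im = Complex.arg q := by
      simp [Complex.log_im, Complex.ofReal_im]
    rw [hre, him]
    refine add_le_add ?_ (Complex.abs_arg_le_pi q)
    have h1 := Real.log_le_log ht0 hlo
    have h2 := Real.log_le_log (by linarith) hup
    rw [Real.log_mul (by norm_num) ht0.ne'] at h2
    have h3 := Real.log_two_lt_d9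
    rw [abs_of_nonneg (by linarith)]
    linarith
  · have : Pk ζ z - Pk ζ' z = ((starRingEnd ℂ) (ζ:ℂ) - (starRingEnd ℂ) (ζ':ℂ)) / (t * q) := by
      rw [Pk, Pk, hrad, ← hq, div_sub_div _ _ htc hq0, ← hrad, hq]
      congr 1; ring
    rw [this, norm_div, hdiff, norm_mul, Complex.norm_real, Real.norm_eq_abs, abs_of_pos ht0]
    have hqp : 0 < ‖q‖ := by linarith
    have : t * (‖e - 1‖ / (t * ‖q‖)) = ‖e - 1‖ / ‖q‖ := by field_simp
    rw [this, le_div_iff₀ hqp]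
    linarith

lemma aux_growth {g : ℂ → ℂ} (hg : DifferentiableOn ℂ g (ball 0 1)) {K : ℝ}
    (hK : ∀ z : ℂ, ‖z‖ < 1 → (1 - ‖z‖) * ‖deriv g z‖ ≤ K) {z : ℂ} (hz : ‖z‖ < 1) :
    ‖g z‖ ≤ ‖g 0‖ + K * (-Real.log (1 - ‖z‖)) := by
  obtain ⟨ζ, hζ⟩ := aux_polar z
  have hζn : ‖(ζ:ℂ)‖ = 1 := by simp
  have hn : ∀ t : ℝ, 0 ≤ t → ‖(t:ℂ) * ζ‖ = t := fun t ht => by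
    rw [norm_mul, hζn, mul_one, Complex.norm_real, Real.norm_eq_abs, abs_of_nonneg ht]
  have hd : ∀ t ∈ Icc (0:ℝ) ‖z‖, HasDerivAt (fun t : ℝ => g (t * ζ)) (deriv g (t * ζ) * ζ) t := by
    intro t ht
    have hm : (t:ℂ) * ζ ∈ ball (0:ℂ) 1 := by
      rw [mem_ball_zero_iff, hn t ht.1]; exact ht.2.trans_lt hz
    have h1 := (hg.differentiableAt (isOpen_ball.mem_nhds hm)).hasDerivAt
    have h2 : HasDerivAt (fun t : ℝ => (t:ℂ) * (ζ:ℂ)) (ζ:ℂ) t := by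
      simpa using (Complex.ofRealCLM.hasDerivAt (x := t)).mul_const (ζ:ℂ)
    exact h1.comp t h2
  have hB : ∀ t ∈ Icc (0:ℝ) ‖z‖, HasDerivAt (fun t : ℝ => ‖g 0‖ + K * (-Real.log (1 - t)))
      (K * (1 / (1 - t))) t := by
    intro t ht
    have h1 : HasDerivAt (fun t : ℝ => 1 - t) (-1) t := by
      simpa using (hasDerivAt_id t).const_sub 1
    have h2 := (((h1.log (by linarith [ht.2])).neg).const_mul K).const_add ‖g 0‖
    refine h2.congr_deriv ?_
    ring
  have := image_norm_le_of_norm_deriv_right_le_deriv_boundary' (a := 0) (b := ‖z‖)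
    (f := fun t : ℝ => g (t * ζ)) (f' := fun t => deriv g (t * ζ) * ζ)
    (fun t ht => (hd t ht).continuousAt.continuousWithinAt)
    (fun t ht => (hd t ⟨ht.1, ht.2.le⟩).hasDerivWithinAt)
    (B := fun t : ℝ => ‖g 0‖ + K * (-Real.log (1 - t))) (B' := fun t => K * (1 / (1 - t)))
    (by simp) (fun t ht => (hB t ht).continuousAt.continuousWithinAt)
    (fun t ht => (hB t ⟨ht.1, ht.2.le⟩).hasDerivWithinAt)
    (by
      intro t ht
      have h1 := hK (t * ζ) (by rw [hn t ht.1]; linarith [ht.2])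
      rw [hn t ht.1] at h1
      rw [norm_mul, hζn, mul_one, mul_one_div, le_div_iff₀ (by linarith [ht.2])]
      linarith) (right_mem_Icc.2 (norm_nonneg z))
  simp only [← hζ] at this
  exact this

/-- **Corollary 2 (part).** Every multiplier of `F₀` is a multiplier of the Bloch space. -/
theorem stmt_12 (f : ℂ → ℂ) (hf : MemM0 f) :
    ∀ g, MemBloch g → MemBloch (fun z => f z * g z) := by
  intro g ⟨hgd, K, hK⟩
  have hK' : ∀ z : ℂ, ‖z‖ < 1 → (1 - ‖z‖) * ‖deriv g z‖ ≤ K := by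
    intro z hz
    have h1 := hK z (by simpa using hz)
    nlinarith [norm_nonneg z, norm_nonneg (deriv g z),
      mul_nonneg (mul_nonneg (norm_nonneg z) (norm_nonneg (deriv g z))) (sub_nonneg.2 hz.le)]
  obtain ⟨C, hC⟩ := aux_key hf
  obtain ⟨C1, hC1⟩ := aux_F0bloch (hf.2 _ aux_one)
  simp only [mul_one] at hC1
  have hbd : ∀ z : ℂ, ‖z‖ < 1 → ‖f z‖ ≤ 4 * (2 * C + C1 * (1 + Real.pi)) := by
    intro z hz
    obtain ⟨ζ, hζ⟩ := aux_polar z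
    obtain ⟨ζ', h1, h2⟩ := aux_rotate hζ hz
    have ha := hC z ζ hz
    have hb := hC z ζ' hz
    have hc := hC1 z hz
    have hp : 0 < 1 - ‖z‖ := by linarith
    have e : f z * (Pk ζ z - Pk ζ' z) = (deriv f z * Lk ζ z + f z * Pk ζ z)
        - (deriv f z * Lk ζ' z + f z * Pk ζ' z) - deriv f z * (Lk ζ z - Lk ζ' z) := by ring
    have hn : ‖f z‖ * ‖Pk ζ z - Pk ζ' z‖ ≤ ‖deriv f z * Lk ζ z + f z * Pk ζ z‖
        + ‖deriv f z * Lk ζ' z + f z * Pk ζ' z‖ + ‖deriv f z‖ * ‖Lk ζ z - Lk ζ' z‖ := by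
      rw [← norm_mul, e, ← norm_mul]
      exact (norm_sub_le _ _).trans (add_le_add (norm_sub_le _ _) le_rfl)
    have h3 := mul_le_mul_of_nonneg_left hn hp.le
    have h4 : (1 - ‖z‖) * ‖deriv f z‖ * ‖Lk ζ z - Lk ζ' z‖ ≤ C1 * (1 + Real.pi) :=
      mul_le_mul hc h1 (norm_nonneg _) (le_trans (by positivity) hc)
    have h5 := mul_le_mul_of_nonneg_left h2 (norm_nonneg (f z))
    linarith
  set B := 4 * (2 * C + C1 * (1 + Real.pi)) with hBdef
  have hlog : ∀ z : ℂ, ‖z‖ < 1 →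
      (1 - ‖z‖) * ‖deriv f z‖ * (-Real.log (1 - ‖z‖)) ≤ C + B := by
    intro z hz
    obtain ⟨ζ, hζ⟩ := aux_polar z
    have hp : 0 < 1 - ‖z‖ := by linarith
    have ha := hC z ζ hz
    have hl : 0 ≤ -Real.log (1 - ‖z‖) := by
      have := Real.log_nonpos hp.le (by linarith [norm_nonneg z]); linarith
    have hn : ‖deriv f z‖ * (-Real.log (1 - ‖z‖)) ≤
        ‖deriv f z * Lk ζ z + f z * Pk ζ z‖ + ‖f z‖ * ‖Pk ζ z‖ := by
      have e : deriv f z * Lk ζ z = (deriv f z * Lk ζ z + f z * Pk ζ z) - f z * Pk ζ z := by ring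
      have e2 : ‖deriv f z * Lk ζ z‖ = ‖deriv f z‖ * (-Real.log (1 - ‖z‖)) := by
        rw [norm_mul, aux_Lrad hζ hz, Complex.norm_real, Real.norm_eq_abs, abs_of_nonneg hl]
      rw [← e2, ← norm_mul]
      conv_lhs => rw [e]
      exact norm_sub_le _ _
    have h3 := mul_le_mul_of_nonneg_left hn hp.le
    have h4 := aux_normP ζ hz
    rw [le_div_iff₀ hp] at h4
    have h5 := mul_le_mul_of_nonneg_left h4 (norm_nonneg (f z))
    have h6 := hbd z hz
    linarith
  refine ⟨hf.1.mul hgd, 2 * (C1 * ‖g 0‖ + K * (C + B) + B * K), fun z hzb => ?_⟩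
  have hz : ‖z‖ < 1 := by simpa using hzb
  have hp : 0 < 1 - ‖z‖ := by linarith
  have hd := ((hf.1.differentiableAt (isOpen_ball.mem_nhds hzb)).hasDerivAt.mul
    (hgd.differentiableAt (isOpen_ball.mem_nhds hzb)).hasDerivAt)
  have hd' : deriv (fun z => f z * g z) z = deriv f z * g z + f z * deriv g z := hd.deriv
  rw [hd']
  have hK0 : 0 ≤ K := le_trans (by positivity) (hK' z hz)
  have hn : ‖deriv f z * g z + f z * deriv g z‖ ≤ ‖deriv f z‖ * ‖g z‖ + ‖f z‖ * ‖deriv g z‖ := by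
    rw [← norm_mul, ← norm_mul]; exact norm_add_le _ _
  have h1 := mul_le_mul_of_nonneg_left (aux_growth hgd hK' hz)
    (mul_nonneg hp.le (norm_nonneg (deriv f z)))
  have h2 := mul_le_mul_of_nonneg_left (hlog z hz) hK0
  have h3 := mul_le_mul_of_nonneg_right (hC1 z hz) (norm_nonneg (g 0))
  have h4 : ‖f z‖ * ((1 - ‖z‖) * ‖deriv g z‖) ≤ B * K :=
    mul_le_mul (hbd z hz) (hK' z hz) (by positivity) (le_trans (norm_nonneg _) (hbd z hz))
  have h5 : (1 - ‖z‖) * ‖deriv f z * g z + f z * deriv g z‖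
      ≤ C1 * ‖g 0‖ + K * (C + B) + B * K := by
    have := mul_le_mul_of_nonneg_left hn hp.le
    linarith
  have h6 : 1 - ‖z‖ ^ 2 ≤ 2 * (1 - ‖z‖) := by nlinarith
  have h7 := mul_le_mul_of_nonneg_left h6 (norm_nonneg (deriv f z * g z + f z * deriv g z))
  linarith
end
end
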